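/- arXiv:math/0307144 — 3 statements merged into one kernel-verified Lean document; each statement's English description precedes it below -/
import Mathlib

section
/- Let N ≥ 3 and C > 0, and let v : ℝ^N → ℝ be continuous on {x : x_N ≥ 0, ‖x‖ ≥ 1}, C² and harmonic (Δv = 0) on {x : x_N > 0, ‖x‖ > 1}, positive on {x : x_N > 0, ‖x‖ > 1}, equal to 0 on {x : x_N = 0, ‖x‖ ≥ 1}, and satisfy v(x) ≤ C·‖x‖^{2-N} for all x with x_N ≥ 0 and ‖x‖ ≥ 1. Then there exist γ ∈ (0,1) and c > 0 such that v(x) ≤ c·‖x‖^{2-N-γ} for every x with x_N > 0 and ‖x‖ ≥ 2. (The paper's Lemma 5.4 in the case a = id, V = 0: a positive harmonic function on a half-space at infinity that vanishes on the boundary hyperplane and is dominated by the fundamental solution decays strictly faster than ‖x‖^{2-N}.) -/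
/-- The Laplacian of `u : ℝ^N → ℝ`: the sum of its second partial derivatives. -/
noncomputable def lap {N : ℕ} (u : EuclideanSpace ℝ (Fin N) → ℝ)
    (x : EuclideanSpace ℝ (Fin N)) : ℝ :=
  ∑ i, fderiv ℝ (fun y => fderiv ℝ u y (EuclideanSpace.single i 1)) x (EuclideanSpace.single i 1)

/-- The last coordinate `x_N` of `x ∈ ℝ^N`. -/
def lastCoord {N : ℕ} (x : EuclideanSpace ℝ (Fin N)) : ℝ :=
  if h : 0 < N then x ⟨N - 1, Nat.sub_lt h Nat.one_pos⟩ else 0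

open Filter Topology

/-- `f` is differentiable near `x`, and its derivative has derivative `d` at `x`. -/
def HasSecondDerivAt (f : ℝ → ℝ) (d x : ℝ) : Prop :=
  ∃ f' : ℝ → ℝ, (∀ᶠ t in 𝓝 x, HasDerivAt f (f' t) t) ∧ HasDerivAt f' d x

namespace HasSecondDerivAt

variable {f g : ℝ → ℝ} {a b x : ℝ}

theorem add (hf : HasSecondDerivAt f a x) (hg : HasSecondDerivAt g b x) :
    HasSecondDerivAt (fun t => f t + g t) (a + b) x := by
  obtain ⟨f', hf, hf'⟩ := hf
  obtain ⟨g', hg, hg'⟩ := hg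
  refine ⟨fun t => f' t + g' t, ?_, hf'.add hg'⟩
  filter_upwards [hf, hg] with t h₁ h₂ using h₁.add h₂

theorem const_mul (c : ℝ) (hf : HasSecondDerivAt f a x) :
    HasSecondDerivAt (fun t => c * f t) (c * a) x := by
  obtain ⟨f', hf, hf'⟩ := hf
  refine ⟨fun t => c * f' t, ?_, hf'.const_mul c⟩
  filter_upwards [hf] with t h using h.const_mul c

theorem nonpos_of_isLocalMax (hf : HasSecondDerivAt f a x) (hmax : IsLocalMax f x) : a ≤ 0 := by
  obtain ⟨f', hf, hf'⟩ := hf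
  by_contra! ha
  have hderiv : deriv f =ᶠ[𝓝 x] f' := hf.mono fun t h => h.deriv
  have hdd : deriv (deriv f) x = a := by rw [hderiv.deriv_eq, hf'.deriv]
  have hmin : IsLocalMin f x :=
    isLocalMin_of_deriv_deriv_pos (by rwa [hdd]) hmax.deriv_eq_zero hf.self_of_nhds.continuousAt
  have hconst : f =ᶠ[𝓝 x] fun _ => f x := by
    filter_upwards [hmin, hmax] with t h₁ h₂ using le_antisymm h₂ h₁
  have hzero : deriv f =ᶠ[𝓝 x] fun _ => 0 := by simpa using hconst.deriv
  rw [hzero.deriv_eq, deriv_const] at hdd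
  exact ha.ne hdd

end HasSecondDerivAt

theorem hasSecondDerivAt_quadratic_mul_rpow (a₀ a₁ a₂ b ρ s : ℝ) (hρ : 0 < ρ) :
    HasSecondDerivAt
      (fun t => (a₀ + a₁ * t + a₂ * t ^ 2) * (ρ + 2 * b * t + t ^ 2) ^ s)
      (2 * a₂ * ρ ^ s + 4 * a₁ * s * b * ρ ^ (s - 1) + 4 * a₀ * s * (s - 1) * b ^ 2 * ρ ^ (s - 2)
        + 2 * a₀ * s * ρ ^ (s - 1)) 0 := by
  have hP (t : ℝ) : HasDerivAt (fun t => a₀ + a₁ * t + a₂ * t ^ 2) (a₁ + 2 * a₂ * t) t := by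
    refine HasDerivAt.congr_deriv ((((hasDerivAt_id t).const_mul a₁).const_add a₀).add
      ((hasDerivAt_pow 2 t).const_mul a₂)) ?_
    simp; ring
  have hP' : HasDerivAt (fun t => a₁ + 2 * a₂ * t) (2 * a₂) 0 := by
    simpa using ((hasDerivAt_id (0 : ℝ)).const_mul (2 * a₂)).const_add a₁
  have hQ (t : ℝ) : HasDerivAt (fun t => ρ + 2 * b * t + t ^ 2) (2 * b + 2 * t) t := by
    refine HasDerivAt.congr_deriv
      ((((hasDerivAt_id t).const_mul (2 * b)).const_add ρ).add (hasDerivAt_pow 2 t)) ?_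
    simp
  have hQ' : HasDerivAt (fun t : ℝ => 2 * b + 2 * t) 2 0 := by
    simpa using ((hasDerivAt_id (0 : ℝ)).const_mul 2).const_add (2 * b)
  have hQpos : ∀ᶠ t in 𝓝 (0 : ℝ), 0 < ρ + 2 * b * t + t ^ 2 :=
    (hQ 0).continuousAt.eventually_const_lt (by simpa using hρ)
  refine ⟨fun t => (a₁ + 2 * a₂ * t) * (ρ + 2 * b * t + t ^ 2) ^ s
    + (a₀ + a₁ * t + a₂ * t ^ 2) *
      ((2 * b + 2 * t) * s * (ρ + 2 * b * t + t ^ 2) ^ (s - 1)), ?_, ?_⟩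
  · filter_upwards [hQpos] with t ht
    exact (hP t).mul ((hQ t).rpow_const (Or.inl ht.ne'))
  · have hne := hQpos.self_of_nhds.ne'
    refine HasDerivAt.congr_deriv ((hP'.mul ((hQ 0).rpow_const (p := s) (Or.inl hne))).add
      ((hP 0).mul ((hQ'.mul_const s).mul ((hQ 0).rpow_const (p := s - 1) (Or.inl hne))))) ?_
    have h : s - 1 - 1 = s - 2 := by ring
    simp [h]
    ring

section Euclidean

variable {N : ℕ}

theorem lap_eq_sum_secondDeriv {u : EuclideanSpace ℝ (Fin N) → ℝ} {x : EuclideanSpace ℝ (Fin N)}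
    (hu : ContDiffAt ℝ 2 u x) :
    ∃ d : Fin N → ℝ, lap u x = ∑ i, d i ∧
      ∀ i, HasSecondDerivAt (fun t => u (x + t • EuclideanSpace.single i 1)) (d i) 0 := by
  refine ⟨_, rfl, fun i => ?_⟩
  set e : EuclideanSpace ℝ (Fin N) := EuclideanSpace.single i 1
  have hline (t : ℝ) : HasDerivAt (fun t : ℝ => x + t • e) e t := by
    simpa using ((hasDerivAt_id t).smul_const e).const_add x
  have hcont : Tendsto (fun t : ℝ => x + t • e) (𝓝 0) (𝓝 x) := by
    simpa using (hline 0).continuousAt.tendsto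
  refine ⟨fun t => fderiv ℝ u (x + t • e) e, ?_, ?_⟩
  · have hdiff : ∀ᶠ y in 𝓝 x, DifferentiableAt ℝ u y :=
      (hu.eventually (by simp)).mono fun y hy => hy.differentiableAt (by simp)
    filter_upwards [hcont.eventually hdiff] with t ht
    exact ht.hasFDerivAt.comp_hasDerivAt t (hline t)
  · have hd : DifferentiableAt ℝ (fun y => fderiv ℝ u y e) x :=
      ((hu.fderiv_right (m := 1) (by norm_num)).differentiableAt (by simp)).clm_apply
        (differentiableAt_const e)
    exact hd.hasFDerivAt.comp_hasDerivAt_of_eq 0 (hline 0) (by simp)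

theorem norm_sq_add_smul_single (x : EuclideanSpace ℝ (Fin N)) (i : Fin N) (t : ℝ) :
    ‖x + t • EuclideanSpace.single i (1 : ℝ)‖ ^ 2 = ‖x‖ ^ 2 + 2 * x i * t + t ^ 2 := by
  rw [norm_add_sq_real, inner_smul_right, EuclideanSpace.inner_single_right, norm_smul]
  simp
  ring

theorem sum_secondDeriv_monomial_mul_rpow (x : EuclideanSpace ℝ (Fin N)) (hx : 0 < ‖x‖ ^ 2)
    (j : Fin N) (a₀ a₁ a₂ s : ℝ) :
    ∑ i, (2 * (if i = j then a₂ else 0) * (‖x‖ ^ 2) ^ s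
        + 4 * (if i = j then a₁ else 0) * s * x i * (‖x‖ ^ 2) ^ (s - 1)
        + 4 * a₀ * s * (s - 1) * x i ^ 2 * (‖x‖ ^ 2) ^ (s - 2)
        + 2 * a₀ * s * (‖x‖ ^ 2) ^ (s - 1))
      = 2 * a₂ * (‖x‖ ^ 2) ^ s
        + (4 * a₁ * s * x j + 4 * a₀ * s * (s - 1) + 2 * N * a₀ * s) * (‖x‖ ^ 2) ^ (s - 1) := by
  have hsum : ∑ i, x i ^ 2 = ‖x‖ ^ 2 := (EuclideanSpace.real_norm_sq_eq x).symm
  have hpow : (‖x‖ ^ 2) ^ (s - 1) = ‖x‖ ^ 2 * (‖x‖ ^ 2) ^ (s - 2) := by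
    rw [mul_comm, ← Real.rpow_add_one hx.ne']
    ring_nf
  simp only [Finset.sum_add_distrib, ← Finset.sum_mul, ← Finset.mul_sum, hsum]
  simp [mul_ite, ite_mul, Finset.sum_ite_eq']
  rw [hpow]
  ring

/-- The barrier `r ^ (-α) (1 + 3 (x j / r) - (x j / r) ^ 2)`, where `r ^ 2 = ‖x‖ ^ 2`. -/
noncomputable def barrier (α : ℝ) (j : Fin N) (x : EuclideanSpace ℝ (Fin N)) : ℝ :=
  1 * (‖x‖ ^ 2) ^ (-α / 2) + 3 * (x j * (‖x‖ ^ 2) ^ (-(α + 1) / 2))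
    + -1 * (x j ^ 2 * (‖x‖ ^ 2) ^ (-(α + 2) / 2))

theorem barrier_eq (α : ℝ) (j : Fin N) {x : EuclideanSpace ℝ (Fin N)} (hx : 0 < ‖x‖) :
    barrier α j x = ‖x‖ ^ (-α) * (1 + 3 * (x j / ‖x‖) - (x j / ‖x‖) ^ 2) := by
  have h (s : ℝ) : (‖x‖ ^ 2) ^ (s / 2) = ‖x‖ ^ s := by
    rw [← Real.rpow_natCast_mul hx.le]
    congr 1
    push_cast
    ring
  have h₁ : ‖x‖ ^ (-(α + 1)) = ‖x‖ ^ (-α) / ‖x‖ := by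
    rw [← Real.rpow_sub_one hx.ne']
    ring_nf
  have h₂ : ‖x‖ ^ (-(α + 2)) = ‖x‖ ^ (-α) / ‖x‖ ^ 2 := by
    rw [← Real.rpow_sub_natCast hx.ne']
    push_cast
    ring_nf
  rw [barrier, h, h, h, h₁, h₂]
  field_simp
  ring

theorem barrier_bounds (α : ℝ) (j : Fin N) {x : EuclideanSpace ℝ (Fin N)} (hx : 0 < ‖x‖)
    (hj : 0 ≤ x j) :
    ‖x‖ ^ (-α) ≤ barrier α j x ∧ barrier α j x ≤ 3 * ‖x‖ ^ (-α) := by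
  have ht0 : 0 ≤ x j / ‖x‖ := by positivity
  have ht1 : x j / ‖x‖ ≤ 1 := by
    rw [div_le_one hx]
    exact (le_abs_self _).trans (PiLp.norm_apply_le x j)
  have hA : 0 < ‖x‖ ^ (-α) := Real.rpow_pos_of_pos hx _
  rw [barrier_eq α j hx]
  constructor
  · refine le_mul_of_one_le_right hA.le ?_
    nlinarith
  · rw [mul_comm]
    refine mul_le_mul_of_nonneg_right ?_ hA.le
    nlinarith

theorem continuousAt_barrier (α : ℝ) (j : Fin N) {x : EuclideanSpace ℝ (Fin N)} (hx : 0 < ‖x‖) :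
    ContinuousAt (barrier α j) x := by
  have h (s : ℝ) : ContinuousAt (fun y : EuclideanSpace ℝ (Fin N) => (‖y‖ ^ 2) ^ s) x :=
    ContinuousAt.rpow_const (by fun_prop) (Or.inl (by positivity))
  have hc : ContinuousAt (fun y : EuclideanSpace ℝ (Fin N) => y j) x := by fun_prop
  exact ((continuousAt_const.mul (h _)).add (continuousAt_const.mul (hc.mul (h _)))).add
    (continuousAt_const.mul ((hc.pow 2).mul (h _)))

/-- The barrier is strictly superharmonic where `x j ≥ 0`, for `α` slightly above `N - 2`. -/
theorem barrier_sum_secondDeriv_neg (hN : 3 ≤ N) {γ : ℝ} (hγ : 0 < γ) (hγN : 2 * γ * N ≤ 1)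
    (j : Fin N) {x : EuclideanSpace ℝ (Fin N)} (hx : 0 < ‖x‖) (hj : 0 ≤ x j) :
    ∃ d : Fin N → ℝ, ∑ i, d i < 0 ∧ ∀ i, HasSecondDerivAt
      (fun t => barrier (N - 2 + γ) j (x + t • EuclideanSpace.single i 1)) (d i) 0 := by
  set α : ℝ := N - 2 + γ with hα
  have hx2 : 0 < ‖x‖ ^ 2 := by positivity
  let D (a₀ a₁ a₂ s : ℝ) (i : Fin N) : ℝ :=
    2 * (if i = j then a₂ else 0) * (‖x‖ ^ 2) ^ s
      + 4 * (if i = j then a₁ else 0) * s * x i * (‖x‖ ^ 2) ^ (s - 1)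
      + 4 * a₀ * s * (s - 1) * x i ^ 2 * (‖x‖ ^ 2) ^ (s - 2)
      + 2 * a₀ * s * (‖x‖ ^ 2) ^ (s - 1)
  refine ⟨fun i => 1 * D 1 0 0 (-α / 2) i + 3 * D (x j) 1 0 (-(α + 1) / 2) i
    + -1 * D (x j ^ 2) (2 * x j) 1 (-(α + 2) / 2) i, ?_, fun i => ?_⟩
  · have h₀ := sum_secondDeriv_monomial_mul_rpow x hx2 j 1 0 0 (-α / 2)
    have h₁ := sum_secondDeriv_monomial_mul_rpow x hx2 j (x j) 1 0 (-(α + 1) / 2)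
    have h₂ := sum_secondDeriv_monomial_mul_rpow x hx2 j (x j ^ 2) (2 * x j) 1 (-(α + 2) / 2)
    rw [Finset.sum_add_distrib, Finset.sum_add_distrib, ← Finset.mul_sum, ← Finset.mul_sum,
      ← Finset.mul_sum]
    simp only [D]
    rw [h₀, h₁, h₂]
    have hp (s k : ℝ) (hs : s = (-α - 2 - k) / 2) :
        (‖x‖ ^ 2) ^ s = ‖x‖ ^ (-α - 2) * ‖x‖ ^ (-k) := by
      rw [← Real.rpow_natCast_mul hx.le, ← Real.rpow_add hx, hs]
      congr 1
      push_cast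
      ring
    obtain ⟨t, ht⟩ : ∃ t, x j = t * ‖x‖ := ⟨x j / ‖x‖, by field_simp⟩
    have ht0 : 0 ≤ t := by
      rw [ht] at hj
      exact nonneg_of_mul_nonneg_left hj hx
    have ht1 : t ≤ 1 := by
      have := (le_abs_self _).trans (PiLp.norm_apply_le x j)
      rw [ht] at this
      exact le_of_mul_le_mul_right (by linarith) hx
    rw [hp (-α / 2 - 1) 0 (by ring), hp (-(α + 1) / 2 - 1) 1 (by ring),
      hp (-(α + 2) / 2 - 1) 2 (by ring), hp (-(α + 2) / 2) 0 (by ring), Real.rpow_neg_one,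
      Real.rpow_neg hx.le 2, Real.rpow_two, neg_zero, Real.rpow_zero, ht]
    have hA : 0 < ‖x‖ ^ (-α - 2) := Real.rpow_pos_of_pos hx _
    have hN' : (3 : ℝ) ≤ N := by exact_mod_cast hN
    have hneg : γ * (N - 2 + γ) * (1 + 3 * t - t ^ 2) - 2 - 3 * (N - 1) * t + 2 * N * t ^ 2 < 0 := by
      have hl : γ * (N - 2 + γ) ≤ 1 / 2 := by nlinarith
      have hφ : 0 ≤ 1 + 3 * t - t ^ 2 := by nlinarith
      have hφ' : 1 + 3 * t - t ^ 2 ≤ 3 := by nlinarith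
      have hq : 2 * N * t ^ 2 - 3 * (N - 1) * t ≤ 0 := by
        nlinarith [mul_nonneg ht0 (sub_nonneg.2 ht1), mul_nonneg ht0 (sub_nonneg.2 hN')]
      have := mul_le_mul_of_nonneg_right hl hφ
      linarith
    calc _ = ‖x‖ ^ (-α - 2) * (γ * (N - 2 + γ) * (1 + 3 * t - t ^ 2) - 2 - 3 * (N - 1) * t
          + 2 * N * t ^ 2) := by
          rw [hα]
          field_simp
          ring
      _ < 0 := mul_neg_of_pos_of_neg hA hneg
  · have h₀ := hasSecondDerivAt_quadratic_mul_rpow 1 (if i = j then 0 else 0)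
      (if i = j then 0 else 0) (x i) (‖x‖ ^ 2) (-α / 2) hx2
    have h₁ := hasSecondDerivAt_quadratic_mul_rpow (x j) (if i = j then 1 else 0)
      (if i = j then 0 else 0) (x i) (‖x‖ ^ 2) (-(α + 1) / 2) hx2
    have h₂ := hasSecondDerivAt_quadratic_mul_rpow (x j ^ 2) (if i = j then 2 * x j else 0)
      (if i = j then 1 else 0) (x i) (‖x‖ ^ 2) (-(α + 2) / 2) hx2
    convert ((h₀.const_mul 1).add (h₁.const_mul 3)).add (h₂.const_mul (-1)) using 1
    funext t
    have hcoord : (x + t • EuclideanSpace.single i (1 : ℝ)) j = x j + if i = j then t else 0 := by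
      by_cases hij : i = j
      · subst hij
        simp
      · simp [hij, Ne.symm hij]
    rw [barrier, norm_sq_add_smul_single, hcoord]
    by_cases hij : i = j
    · subst hij
      simp only [if_true]
      ring
    · simp [hij]

end Euclidean

/-- A positive harmonic function on a half-space at infinity which vanishes on the
boundary hyperplane and is dominated by `C‖x‖^{2-N}` decays strictly faster than
`‖x‖^{2-N}` (the paper's Lemma 5.4 for `a = id`, `V = 0`). -/
theorem halfspace_harmonic_improved_decay
    (N : ℕ) (hN : 3 ≤ N) (C : ℝ) (hC : 0 < C)
    (v : EuclideanSpace ℝ (Fin N) → ℝ)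
    (hcont : ContinuousOn v {x | 0 ≤ lastCoord x ∧ 1 ≤ ‖x‖})
    (hC2 : ContDiffOn ℝ 2 v {x | 0 < lastCoord x ∧ 1 < ‖x‖})
    (hharm : ∀ x : EuclideanSpace ℝ (Fin N), 0 < lastCoord x → 1 < ‖x‖ → lap v x = 0)
    (hpos : ∀ x : EuclideanSpace ℝ (Fin N), 0 < lastCoord x → 1 < ‖x‖ → 0 < v x)
    (hzero : ∀ x : EuclideanSpace ℝ (Fin N), lastCoord x = 0 → 1 ≤ ‖x‖ → v x = 0)
    (hbound : ∀ x : EuclideanSpace ℝ (Fin N), 0 ≤ lastCoord x → 1 ≤ ‖x‖ →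
      v x ≤ C * ‖x‖ ^ (2 - (N : ℝ))) :
    ∃ γ ∈ Set.Ioo (0 : ℝ) 1, ∃ c > (0 : ℝ), ∀ x : EuclideanSpace ℝ (Fin N),
      0 < lastCoord x → 2 ≤ ‖x‖ → v x ≤ c * ‖x‖ ^ (2 - (N : ℝ) - γ) := by
  set j : Fin N := ⟨N - 1, Nat.sub_lt (by omega) Nat.one_pos⟩
  have hlast (x : EuclideanSpace ℝ (Fin N)) : lastCoord x = x j := by
    rw [lastCoord, dif_pos (by omega : 0 < N)]
  simp only [hlast] at *
  have hN' : (3 : ℝ) ≤ N := by exact_mod_cast hN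
  have hcj : Continuous fun y : EuclideanSpace ℝ (Fin N) => y j := by fun_prop
  set γ : ℝ := 1 / (2 * N) with hγdef
  have hγ : 0 < γ := by positivity
  have hγN : 2 * γ * N ≤ 1 := le_of_eq (by rw [hγdef]; field_simp)
  have hγ1 : γ < 1 := by nlinarith
  set w : EuclideanSpace ℝ (Fin N) → ℝ := barrier (N - 2 + γ) j
  have hw (x : EuclideanSpace ℝ (Fin N)) (hx : 0 ≤ x j) (hx1 : 1 ≤ ‖x‖) :=
    barrier_bounds (N - 2 + γ) j (zero_lt_one.trans_le hx1) hx
  have hwpos (x : EuclideanSpace ℝ (Fin N)) (hx : 0 ≤ x j) (hx1 : 1 ≤ ‖x‖) : 0 < w x :=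
    (Real.rpow_pos_of_pos (zero_lt_one.trans_le hx1) _).trans_le (hw x hx hx1).1
  have key (x : EuclideanSpace ℝ (Fin N)) (hx : 0 < x j) (hx1 : 1 ≤ ‖x‖) : v x ≤ C * w x := by
    by_contra! hlt
    set m : ℝ := v x + -C * w x with hm
    have hm0 : 0 < m := by rw [hm]; linarith
    obtain ⟨R, hR⟩ : ∃ R, ∀ r, R ≤ r → C * r ^ (2 - (N : ℝ)) < m := by
      have ht : Tendsto (fun r : ℝ => C * r ^ (2 - (N : ℝ))) atTop (𝓝 0) := by
        simpa using (tendsto_rpow_neg_atTop (y := N - 2) (by linarith)).const_mul C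
      exact eventually_atTop.1 (ht.eventually_lt_const hm0)
    have hfar (y : EuclideanSpace ℝ (Fin N)) (hy : 0 ≤ y j) (hy1 : 1 ≤ ‖y‖) (hyR : R ≤ ‖y‖) :
        v y + -C * w y < m := by
      have h₁ := hbound y hy hy1
      have h₂ := mul_pos hC (hwpos y hy hy1)
      have h₃ := hR _ hyR
      linarith
    set K : Set (EuclideanSpace ℝ (Fin N)) := {y | 0 ≤ y j ∧ 1 ≤ ‖y‖ ∧ ‖y‖ ≤ R}
    have hKc : IsCompact K := by
      refine (isCompact_closedBall (0 : EuclideanSpace ℝ (Fin N)) R).of_isClosed_subset ?_ ?_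
      · exact (isClosed_le continuous_const hcj).inter
          ((isClosed_le continuous_const continuous_norm).inter
            (isClosed_le continuous_norm continuous_const))
      · intro y hy
        simpa using hy.2.2
    have hxK : x ∈ K := ⟨hx.le, hx1, le_of_not_ge fun h => (hfar x hx.le hx1 h).false⟩
    have hcontK : ContinuousOn (fun y => v y + -C * w y) K := by
      refine (hcont.mono fun y hy => ⟨hy.1, hy.2.1⟩).add (continuousOn_const.mul fun y hy => ?_)
      exact (continuousAt_barrier _ j (zero_lt_one.trans_le hy.2.1)).continuousWithinAt
    obtain ⟨p, hp, hpmax⟩ := hKc.exists_isMaxOn ⟨x, hxK⟩ hcontK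
    have hmp : m ≤ v p + -C * w p := hpmax hxK
    have hwp := mul_pos hC (hwpos p hp.1 hp.2.1)
    have hpj : 0 < p j := by
      refine hp.1.lt_of_ne fun h => ?_
      have := hzero p h.symm hp.2.1
      linarith
    have hp1 : 1 < ‖p‖ := by
      refine hp.2.1.lt_of_ne fun h => ?_
      have h₁ := hbound p hp.1 hp.2.1
      have h₂ := (hw p hp.1 hp.2.1).1
      rw [← h, Real.one_rpow] at h₁ h₂
      have h₃ := mul_le_mul_of_nonneg_left h₂ hC.le
      linarith
    have hpR : ‖p‖ < R := by
      refine lt_of_not_ge fun h => ?_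
      exact (hfar p hp.1 hp.2.1 h).not_ge hmp
    have hopen : IsOpen {y : EuclideanSpace ℝ (Fin N) | 0 < y j ∧ 1 < ‖y‖} :=
      (isOpen_lt continuous_const hcj).inter (isOpen_lt continuous_const continuous_norm)
    have hlocal : IsLocalMax (fun y => v y + -C * w y) p := by
      refine hpmax.isLocalMax ?_
      have hball : {y : EuclideanSpace ℝ (Fin N) | ‖y‖ < R} ∈ 𝓝 p :=
        (isOpen_lt (by fun_prop) (by fun_prop)).mem_nhds hpR
      filter_upwards [hopen.mem_nhds ⟨hpj, hp1⟩, hball] with y hy hyR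
      exact ⟨hy.1.le, hy.2.le, le_of_lt hyR⟩
    obtain ⟨d, hd, hd'⟩ :=
      lap_eq_sum_secondDeriv (hC2.contDiffAt (hopen.mem_nhds ⟨hpj, hp1⟩))
    obtain ⟨e, he, he'⟩ :=
      barrier_sum_secondDeriv_neg hN hγ hγN j (zero_lt_one.trans hp1) hpj.le
    have hle (i : Fin N) : d i + -C * e i ≤ 0 := by
      refine ((hd' i).add ((he' i).const_mul (-C))).nonpos_of_isLocalMax ?_
      have hline : ContinuousAt
          (fun t : ℝ => p + t • (EuclideanSpace.single i 1 : EuclideanSpace ℝ (Fin N))) 0 := by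
        fun_prop
      exact IsLocalMax.comp_continuous (f := fun y => v y + -C * w y)
        (g := fun t : ℝ => p + t • EuclideanSpace.single i 1) (by simpa using hlocal) hline
    have hsum := Finset.sum_nonpos fun i (_ : i ∈ Finset.univ) => hle i
    rw [Finset.sum_add_distrib, ← Finset.mul_sum, ← hd, hharm p hpj hp1] at hsum
    nlinarith [mul_neg_of_pos_of_neg hC he]
  refine ⟨γ, ⟨hγ, hγ1⟩, 3 * C, by positivity, fun x hx hx2 => ?_⟩
  have hx1 : 1 ≤ ‖x‖ := by linarith
  have h := mul_le_mul_of_nonneg_left (hw x hx.le hx1).2 hC.le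
  rw [show 2 - (N : ℝ) - γ = -(N - 2 + γ) by ring]
  linarith [key x hx hx1]
end

section
/- Let N ≥ 3 and define S := {p : ℝ | p > 1 and there exist ρ > 0 and a function u : ℝ^N → ℝ which is C² on C₊ ∩ {x : ‖x‖ > ρ}, positive there, and satisfies -Δu(x) ≥ u(x)^p for all x ∈ C₊ with ‖x‖ > ρ}. Then S = {p : ℝ | p > (N+1)/(N-1)}; in particular sInf S = (N+1)/(N-1) and (N+1)/(N-1) ∉ S. (The paper's Theorem 1.3 for the upper hemisphere Ω: the critical exponent of -Δu = u^p on the half-space cone equals 1 - 2/α₋ = (N+1)/(N-1), and there is no positive supersolution at infinity at the critical exponent itself.) -/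
open Filter Topology MeasureTheory

/-- The Laplacian of the product of a function of one coordinate and a radial function. -/
theorem lap_coord_mul_radial {N : ℕ} (j : Fin N) {a a' β β' : ℝ → ℝ} {a'' β'' : ℝ}
    (x : EuclideanSpace ℝ (Fin N))
    (ha : ∀ t, HasDerivAt a (a' t) t) (ha' : HasDerivAt a' a'' (x j))
    (hβ : ∀ᶠ q in 𝓝 (‖x‖ ^ 2), HasDerivAt β (β' q) q) (hβ' : HasDerivAt β' β'' (‖x‖ ^ 2)) :
    lap (fun y => a (y j) * β (‖y‖ ^ 2)) x =
      a'' * β (‖x‖ ^ 2) + 4 * (x j * a' (x j)) * β' (‖x‖ ^ 2) +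
        a (x j) * (4 * ‖x‖ ^ 2 * β'' + 2 * N * β' (‖x‖ ^ 2)) := by
  have hproj : ∀ (i : Fin N) (y : EuclideanSpace ℝ (Fin N)),
      HasFDerivAt (fun z : EuclideanSpace ℝ (Fin N) => z i) (EuclideanSpace.proj (𝕜 := ℝ) i) y :=
    fun i y => (EuclideanSpace.proj (𝕜 := ℝ) i).hasFDerivAt
  have hcont : Tendsto (fun y : EuclideanSpace ℝ (Fin N) => ‖y‖ ^ 2) (𝓝 x) (𝓝 (‖x‖ ^ 2)) :=
    (continuous_norm.pow 2).continuousAt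
  have h1 : ∀ᶠ y in 𝓝 x, ∀ i : Fin N,
      fderiv ℝ (fun y : EuclideanSpace ℝ (Fin N) => a (y j) * β (‖y‖ ^ 2)) y
        (EuclideanSpace.single i 1) =
      a' (y j) * (if j = i then 1 else 0) * β (‖y‖ ^ 2) +
        a (y j) * β' (‖y‖ ^ 2) * (2 * y i) := by
    filter_upwards [hcont.eventually hβ] with y hy i
    have h := ((ha (y j)).comp_hasFDerivAt y (hproj j y)).mul
      (hy.comp_hasFDerivAt y (hasStrictFDerivAt_norm_sq y).hasFDerivAt)
    have h' : HasFDerivAt (fun y : EuclideanSpace ℝ (Fin N) => a (y j) * β (‖y‖ ^ 2)) _ y := h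
    rw [h'.fderiv]
    simp [EuclideanSpace.inner_single_right]
    ring_nf
  have h2 : ∀ i : Fin N,
      fderiv ℝ (fun y => fderiv ℝ (fun y : EuclideanSpace ℝ (Fin N) => a (y j) * β (‖y‖ ^ 2)) y
        (EuclideanSpace.single i 1)) x (EuclideanSpace.single i 1) =
      (if j = i then a'' * β (‖x‖ ^ 2) + 4 * (x j * a' (x j)) * β' (‖x‖ ^ 2) else 0) +
        (4 * a (x j) * β'' * x i ^ 2 + 2 * a (x j) * β' (‖x‖ ^ 2)) := by
    intro i
    have he : (fun y => fderiv ℝ (fun y : EuclideanSpace ℝ (Fin N) => a (y j) * β (‖y‖ ^ 2)) y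
        (EuclideanSpace.single i 1)) =ᶠ[𝓝 x] fun y =>
        a' (y j) * (if j = i then 1 else 0) * β (‖y‖ ^ 2) +
        a (y j) * β' (‖y‖ ^ 2) * (2 * y i) := h1.mono fun y hy => hy i
    rw [he.fderiv_eq]
    have hq := (hasStrictFDerivAt_norm_sq x).hasFDerivAt
    have h := (((ha'.comp_hasFDerivAt x (hproj j x)).mul_const
        (if j = i then (1 : ℝ) else 0)).mul (hβ.self_of_nhds.comp_hasFDerivAt x hq)).add
      ((((ha (x j)).comp_hasFDerivAt x (hproj j x)).mul (hβ'.comp_hasFDerivAt x hq)).mul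
        ((hproj i x).const_mul 2))
    have h' : HasFDerivAt (fun y : EuclideanSpace ℝ (Fin N) =>
        a' (y j) * (if j = i then 1 else 0) * β (‖y‖ ^ 2) +
        a (y j) * β' (‖y‖ ^ 2) * (2 * y i)) _ x := h
    rw [h'.fderiv]
    by_cases hij : j = i
    · subst hij
      simp [EuclideanSpace.inner_single_right]
      ring
    · simp [EuclideanSpace.inner_single_right, hij]
      ring
  unfold lap
  rw [Finset.sum_congr rfl fun i _ => h2 i, Finset.sum_add_distrib, Finset.sum_add_distrib,
    ← Finset.mul_sum, ← EuclideanSpace.real_norm_sq_eq]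
  simp
  ring

/-- Green's second identity for a compactly supported test function. -/
theorem integral_mul_lap_comm {N : ℕ} {φ v : EuclideanSpace ℝ (Fin N) → ℝ}
    (hφ : ContDiff ℝ 2 φ) (hφc : HasCompactSupport φ) (hv : ContDiff ℝ 2 v) :
    Integrable (fun x => φ x * lap v x) ∧ Integrable (fun x => v x * lap φ x) ∧
      ∫ x, φ x * lap v x = ∫ x, v x * lap φ x := by
  have hd1 : ∀ {f : EuclideanSpace ℝ (Fin N) → ℝ}, ContDiff ℝ 2 f → ∀ e,
      ContDiff ℝ 1 (fun y => fderiv ℝ f y e) := fun hf e =>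
    (hf.fderiv_right (m := 1) (by norm_num)).clm_apply contDiff_const
  have hd2 : ∀ {f : EuclideanSpace ℝ (Fin N) → ℝ}, ContDiff ℝ 2 f → ∀ e,
      Continuous (fun x => fderiv ℝ (fun y => fderiv ℝ f y e) x e) := fun hf e =>
    ((hd1 hf e).continuous_fderiv one_ne_zero).clm_apply continuous_const
  have hc1 : ∀ e, HasCompactSupport (fun y => fderiv ℝ φ y e) := fun e =>
    hφc.fderiv_apply ℝ e
  have hc2 : ∀ e, HasCompactSupport (fun x => fderiv ℝ (fun y => fderiv ℝ φ y e) x e) :=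
    fun e => (hc1 e).fderiv_apply ℝ e
  have i1 : ∀ e, Integrable (fun x => φ x * fderiv ℝ (fun y => fderiv ℝ v y e) x e) := fun e =>
    (hφ.continuous.mul (hd2 hv e)).integrable_of_hasCompactSupport hφc.mul_right
  have i2 : ∀ e, Integrable (fun x => v x * fderiv ℝ (fun y => fderiv ℝ φ y e) x e) := fun e =>
    (hv.continuous.mul (hd2 hφ e)).integrable_of_hasCompactSupport (hc2 e).mul_left
  have i3 : ∀ e, Integrable (fun x => fderiv ℝ φ x e * fderiv ℝ v x e) := fun e =>
    ((hd1 hφ e).continuous.mul (hd1 hv e).continuous).integrable_of_hasCompactSupport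
      (hc1 e).mul_right
  have i4 : ∀ e, Integrable (fun x => φ x * fderiv ℝ v x e) := fun e =>
    (hφ.continuous.mul (hd1 hv e).continuous).integrable_of_hasCompactSupport hφc.mul_right
  have i5 : ∀ e, Integrable (fun x => v x * fderiv ℝ φ x e) := fun e =>
    (hv.continuous.mul (hd1 hφ e).continuous).integrable_of_hasCompactSupport (hc1 e).mul_left
  have key : ∀ e, ∫ x, φ x * fderiv ℝ (fun y => fderiv ℝ v y e) x e =
      ∫ x, v x * fderiv ℝ (fun y => fderiv ℝ φ y e) x e := by
    intro e
    rw [integral_mul_fderiv_eq_neg_fderiv_mul_of_integrable (i3 e) (i1 e) (i4 e)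
        (fun x _ => (hφ.differentiable (by norm_num)) x)
        (fun x _ => ((hd1 hv e).differentiable (by norm_num)) x),
      integral_mul_fderiv_eq_neg_fderiv_mul_of_integrable (by simpa only [mul_comm] using i3 e)
        (i2 e) (i5 e)
        (fun x _ => (hv.differentiable (by norm_num)) x)
        (fun x _ => ((hd1 hφ e).differentiable (by norm_num)) x)]
    simp only [mul_comm]
  simp only [lap, Finset.mul_sum]
  refine ⟨integrable_finsetSum _ fun i _ => i1 _, integrable_finsetSum _ fun i _ => i2 _, ?_⟩
  rw [integral_finsetSum _ fun i _ => i1 _, integral_finsetSum _ fun i _ => i2 _]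
  exact Finset.sum_congr rfl fun i _ => key _

/-- A supersolution in a neighbourhood of the closed region `{x_j ≥ 0, ‖x‖² ≥ r}` obtained by a
unit translation, and extended to a globally `C²` function. -/
theorem exists_global_supersolution {N : ℕ} (j : Fin N) {p ρ : ℝ}
    {u : EuclideanSpace ℝ (Fin N) → ℝ}
    (hu : ContDiffOn ℝ 2 u {x | 0 < x j ∧ ρ < ‖x‖})
    (hpos : ∀ x : EuclideanSpace ℝ (Fin N), 0 < x j → ρ < ‖x‖ → 0 < u x)
    (hsuper : ∀ x : EuclideanSpace ℝ (Fin N), 0 < x j → ρ < ‖x‖ → -lap u x ≥ u x ^ p) :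
    ∃ v : EuclideanSpace ℝ (Fin N) → ℝ, ContDiff ℝ 2 v ∧
      ∀ x : EuclideanSpace ℝ (Fin N), 0 ≤ x j → ρ ^ 2 ≤ ‖x‖ ^ 2 →
        0 < v x ∧ v x ^ p ≤ -lap v x := by
  set e : EuclideanSpace ℝ (Fin N) := EuclideanSpace.single j 1 with he
  set Ω : Set (EuclideanSpace ℝ (Fin N)) := {x | 0 < (x + e) j ∧ ρ < ‖x + e‖} with hΩ
  set K : Set (EuclideanSpace ℝ (Fin N)) := {x | 0 ≤ x j ∧ ρ ^ 2 ≤ ‖x‖ ^ 2} with hK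
  have hcoord : Continuous fun x : EuclideanSpace ℝ (Fin N) => x j :=
    (EuclideanSpace.proj (𝕜 := ℝ) j).continuous
  have hU : IsOpen {x : EuclideanSpace ℝ (Fin N) | 0 < x j ∧ ρ < ‖x‖} :=
    (isOpen_lt continuous_const hcoord).inter (isOpen_lt continuous_const continuous_norm)
  have hadd : Continuous fun x : EuclideanSpace ℝ (Fin N) => x + e :=
    continuous_id.add continuous_const
  have hΩo : IsOpen Ω := hU.preimage hadd
  have hKc : IsClosed K := (isClosed_le continuous_const hcoord).inter
    (isClosed_le continuous_const (continuous_norm.pow 2))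
  have hKΩ : K ⊆ Ω := by
    rintro x ⟨h0, h1⟩
    have h2 : (x + e) j = x j + 1 := by simp [he]
    have h3 : ‖x + e‖ ^ 2 = ‖x‖ ^ 2 + 2 * x j + 1 := by
      rw [norm_add_sq_real]
      simp [he, EuclideanSpace.inner_single_right]
    refine ⟨by linarith, ?_⟩
    exact lt_of_pow_lt_pow_left₀ 2 (norm_nonneg _) (by rw [h3]; linarith)
  have hw : ContDiffOn ℝ 2 (fun x => u (x + e)) Ω :=
    hu.comp (contDiff_id.add contDiff_const).contDiffOn fun x hx => hx
  obtain ⟨F, hFc, hFΩ⟩ := normal_exists_closure_subset hKc hΩo hKΩ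
  obtain ⟨hFK, hcl⟩ := hFΩ
  obtain ⟨χ, hχ1, hχ0, -⟩ := exists_contMDiffMap_one_nhds_of_subset_interior
    (modelWithCornersSelf ℝ (EuclideanSpace ℝ (Fin N))) (n := 2) (s := K) (t := F) hKc
    (by rwa [hFc.interior_eq])
  have hχc : ContDiff ℝ 2 χ := χ.contMDiff.contDiff
  refine ⟨fun x => χ x * u (x + e), ?_, ?_⟩
  · rw [contDiff_iff_contDiffAt]
    intro x
    by_cases hx : x ∈ Ω
    · exact hχc.contDiffAt.mul (hw.contDiffAt (hΩo.mem_nhds hx))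
    · have hx' : (closure F)ᶜ ∈ 𝓝 x :=
        isClosed_closure.isOpen_compl.mem_nhds fun h => hx (hcl h)
      have : (fun x => χ x * u (x + e)) =ᶠ[𝓝 x] fun _ => 0 := by
        filter_upwards [hx'] with y hy
        rw [hχ0 y fun h => hy (subset_closure h), zero_mul]
      exact contDiffAt_const.congr_of_eventuallyEq this
  · intro x hx0 hx1
    have hxK : x ∈ K := ⟨hx0, hx1⟩
    have hev : (fun x => χ x * u (x + e)) =ᶠ[𝓝 x] fun x => u (x + e) := by
      filter_upwards [hχ1.filter_mono (nhds_le_nhdsSet hxK)] with y hy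
      rw [hy, one_mul]
    have hlap : lap (fun x => χ x * u (x + e)) x = lap u (x + e) := by
      unfold lap
      refine Finset.sum_congr rfl fun i _ => ?_
      have h1 : (fun y => fderiv ℝ (fun x => χ x * u (x + e)) y (EuclideanSpace.single i 1))
          =ᶠ[𝓝 x] fun y => (fun z => fderiv ℝ u z (EuclideanSpace.single i 1)) (y + e) := by
        filter_upwards [hev.fderiv (𝕜 := ℝ)] with y hy
        rw [hy, fderiv_comp_add_right]
      rw [h1.fderiv_eq,
        fderiv_comp_add_right (f := fun z => fderiv ℝ u z (EuclideanSpace.single i 1)) e]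
    have hx := hKΩ hxK
    have hvx := hev.self_of_nhds
    simp only at hvx
    simp only [hlap, hvx]
    exact ⟨hpos _ hx.1 hx.2, hsuper _ hx.1 hx.2⟩


/-- Gluing a function vanishing to first order at `c` with the zero function. -/
theorem hasDerivAt_glue_zero {f f' : ℝ → ℝ} {c : ℝ} (h0 : f c = 0) (h0' : f' c = 0)
    (hf : ∀ t, c ≤ t → HasDerivAt f (f' t) t) (t : ℝ) :
    HasDerivAt (fun s => if c ≤ s then f s else 0) (if c ≤ t then f' t else 0) t := by
  rcases lt_trichotomy t c with h | h | h
  · rw [if_neg h.not_ge]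
    refine (hasDerivAt_const t (0 : ℝ)).congr_of_eventuallyEq ?_
    filter_upwards [Iio_mem_nhds h] with s hs
    rw [if_neg (not_le.2 hs)]
  · subst h
    rw [if_pos le_rfl]
    have h1 : HasDerivWithinAt (fun s => if t ≤ s then f s else 0) (f' t) (Set.Ici t) t :=
      (hf t le_rfl).hasDerivWithinAt.congr (fun s hs => if_pos hs) (if_pos le_rfl)
    have h2 : HasDerivWithinAt (fun s => if t ≤ s then f s else 0) (f' t) (Set.Iic t) t := by
      rw [h0']
      refine (hasDerivWithinAt_const t _ (0 : ℝ)).congr (fun s hs => ?_) (by simp [h0])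
      rcases eq_or_lt_of_le (show s ≤ t from hs) with h | h
      · simp [h, h0]
      · exact if_neg h.not_ge
    simpa using h2.union h1
  · rw [if_pos h.le]
    refine (hf t h.le).congr_of_eventuallyEq ?_
    filter_upwards [Ioi_mem_nhds h] with s hs
    rw [if_pos (le_of_lt hs)]

/-- Gluing a continuous function vanishing at `c` with the zero function. -/
theorem continuous_glue_zero {f : ℝ → ℝ} {c : ℝ} (h0 : f c = 0)
    (hf : ContinuousOn f (Set.Ici c)) : Continuous (fun s => if c ≤ s then f s else 0) := by
  refine continuous_if_le continuous_const continuous_id hf continuousOn_const ?_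
  rintro x rfl
  exact h0

/-- A convex `C²` ramp: zero on `(-∞, 0]`, of linear growth on `[0, ∞)`. -/
theorem exists_convex_ramp : ∃ a a' a'' : ℝ → ℝ, (∀ t, HasDerivAt a (a' t) t) ∧
    (∀ t, HasDerivAt a' (a'' t) t) ∧ Continuous a'' ∧
    (∀ t, t ≤ 0 → a t = 0 ∧ a' t = 0 ∧ a'' t = 0) ∧
    ∀ t, 0 < t → 0 < a t ∧ a t ≤ t ∧ 0 ≤ a'' t ∧ a t ≤ t * a' t ∧ t * a' t ≤ 3 * a t := by
  refine ⟨fun t => if 0 ≤ t then t ^ 3 / (1 + t) ^ 2 else 0,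
    fun t => if 0 ≤ t then (t ^ 3 + 3 * t ^ 2) / (1 + t) ^ 3 else 0,
    fun t => if 0 ≤ t then 6 * t / (1 + t) ^ 4 else 0, ?_, ?_, ?_, ?_, ?_⟩
  · refine hasDerivAt_glue_zero (by simp) (by simp) fun t ht => ?_
    have h1 : (1 + t) ≠ 0 := by positivity
    have h := (hasDerivAt_pow 3 t).div (((hasDerivAt_id t).const_add 1).pow 2) (pow_ne_zero 2 h1)
    refine h.congr_deriv ?_
    simp only [id_eq, Pi.pow_apply]
    field_simp
    push_cast
    ring
  · refine hasDerivAt_glue_zero (by simp) (by simp) fun t ht => ?_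
    have h1 : (1 + t) ≠ 0 := by positivity
    have h := ((hasDerivAt_pow 3 t).add ((hasDerivAt_pow 2 t).const_mul 3)).div
      (((hasDerivAt_id t).const_add 1).pow 3) (pow_ne_zero 3 h1)
    refine h.congr_deriv ?_
    simp only [id_eq, Pi.pow_apply, Pi.add_apply]
    field_simp
    push_cast
    ring
  · refine continuous_glue_zero (by simp) (ContinuousOn.div (by fun_prop) (by fun_prop) ?_)
    intro t ht
    have : (0 : ℝ) ≤ t := ht
    positivity
  · intro t ht
    rcases eq_or_lt_of_le ht with h | h
    · simp [h]
    · simp [h.not_ge]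
  · intro t ht
    simp only [if_pos ht.le]
    refine ⟨by positivity, ?_, by positivity, ?_, ?_⟩
    · rw [div_le_iff₀ (by positivity)]
      nlinarith [pow_pos ht 2, pow_pos ht 3]
    · rw [mul_div_assoc', div_le_div_iff₀ (by positivity) (by positivity)]
      have : t * (t ^ 3 + 3 * t ^ 2) * (1 + t) ^ 2 - t ^ 3 * (1 + t) ^ 3
        = 2 * t ^ 3 * (1 + t) ^ 2 := by ring
      nlinarith [show 0 ≤ 2 * t ^ 3 * (1 + t) ^ 2 by positivity]
    · rw [mul_div_assoc', mul_div_assoc', div_le_div_iff₀ (by positivity) (by positivity)]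
      have : 3 * t ^ 3 * (1 + t) ^ 3 - t * (t ^ 3 + 3 * t ^ 2) * (1 + t) ^ 2
        = 2 * t ^ 4 * (1 + t) ^ 2 := by ring
      nlinarith [show 0 ≤ 2 * t ^ 4 * (1 + t) ^ 2 by positivity]

/-- A bounded nondecreasing radial profile vanishing for `q ≤ r`, whose product with a coordinate
is subharmonic. -/
theorem exists_radial_profile {N : ℕ} (hN : 2 ≤ N) {r : ℝ} (hr : 0 < r) :
    ∃ b b' b'' : ℝ → ℝ, (∀ q, HasDerivAt b (b' q) q) ∧ (∀ q, HasDerivAt b' (b'' q) q) ∧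
      Continuous b'' ∧ (∀ q, q ≤ r → b q = 0 ∧ b' q = 0 ∧ b'' q = 0) ∧
      ∀ q, r < q → 0 < b q ∧ b q ≤ 1 ∧ 0 ≤ b' q ∧ 0 ≤ 4 * q * b'' q + (2 * N + 4) * b' q ∧
        q * b' q ≤ 3 ∧ q ^ 2 * |b'' q| ≤ 12 ∧ (2 * r ≤ q → 1 / 8 ≤ b q) := by
  refine ⟨fun q => if r ≤ q then (1 - r / q) ^ 3 else 0,
    fun q => if r ≤ q then 3 * (1 - r / q) ^ 2 * (r / q ^ 2) else 0,
    fun q => if r ≤ q then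
      6 * (1 - r / q) * (r / q ^ 2) ^ 2 - 6 * (1 - r / q) ^ 2 * (r / q ^ 3) else 0,
    ?_, ?_, ?_, ?_, ?_⟩
  · refine hasDerivAt_glue_zero (by simp [hr.ne']) (by simp [hr.ne']) fun q hq => ?_
    have hq0 : q ≠ 0 := (hr.trans_le hq).ne'
    have h := (((hasDerivAt_inv hq0).const_mul r).const_sub 1).pow 3
    refine (h.congr_deriv ?_).congr_of_eventuallyEq (.of_forall fun s => ?_)
    · norm_num
      field_simp
    · simp [div_eq_mul_inv]
  · refine hasDerivAt_glue_zero (by simp [hr.ne']) (by simp [hr.ne']) fun q hq => ?_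
    have hq0 : q ≠ 0 := (hr.trans_le hq).ne'
    have h := ((((hasDerivAt_inv hq0).const_mul r).const_sub 1).pow 2).mul
      (((hasDerivAt_inv hq0).pow 2).const_mul (3 * r))
    refine (h.congr_deriv ?_).congr_of_eventuallyEq (.of_forall fun s => ?_)
    · simp only [Pi.pow_apply]
      norm_num
      field_simp
      ring
    · simp [div_eq_mul_inv]
      ring
  · refine continuous_glue_zero (by simp [hr.ne']) fun q hq => ?_
    have hq0 : q ≠ 0 := (hr.trans_le hq).ne'
    refine ContinuousAt.continuousWithinAt ?_
    fun_prop (disch := first | assumption | positivity)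
  · intro q hq
    rcases eq_or_lt_of_le hq with h | h
    · simp [h, hr.ne']
    · simp [h.not_ge]
  · intro q hq
    have hq0 : 0 < q := hr.trans hq
    simp only [if_pos hq.le]
    have hN' : (2 : ℝ) ≤ N := by exact_mod_cast hN
    obtain ⟨m, hm⟩ : ∃ m, m = r / q := ⟨_, rfl⟩
    have hm0 : 0 < m := by rw [hm]; positivity
    have hm1 : m < 1 := by rw [hm, div_lt_one hq0]; exact hq
    have e2 : r / q ^ 2 = m / q := by rw [hm]; field_simp
    have e3 : r / q ^ 3 = m / q ^ 2 := by rw [hm]; field_simp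
    rw [e2, e3, ← hm]
    have hk : 0 < 1 - m := by linarith
    refine ⟨by positivity, pow_le_one₀ hk.le (by linarith), by positivity, ?_, ?_, ?_, ?_⟩
    · have : 4 * q * (6 * (1 - m) * (m / q) ^ 2 - 6 * (1 - m) ^ 2 * (m / q ^ 2)) +
          (2 * N + 4) * (3 * (1 - m) ^ 2 * (m / q)) =
          (24 * (1 - m) * m ^ 2 + (6 * N - 12) * ((1 - m) ^ 2 * m)) / q := by
        field_simp
        ring
      rw [this]
      have : (0 : ℝ) ≤ 6 * N - 12 := by linarith
      positivity
    · have : q * (3 * (1 - m) ^ 2 * (m / q)) = 3 * ((1 - m) ^ 2 * m) := by field_simp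
      rw [this]
      have : (1 - m) ^ 2 * m ≤ 1 :=
        mul_le_one₀ (pow_le_one₀ hk.le (by linarith)) hm0.le hm1.le
      linarith
    · rw [← abs_of_pos (show (0 : ℝ) < q ^ 2 by positivity), ← abs_mul,
        abs_of_pos (show (0 : ℝ) < q ^ 2 by positivity)]
      have : q ^ 2 * (6 * (1 - m) * (m / q) ^ 2 - 6 * (1 - m) ^ 2 * (m / q ^ 2)) =
          6 * ((1 - m) * m ^ 2) - 6 * ((1 - m) ^ 2 * m) := by field_simp
      rw [this]
      have h1 : (1 - m) ^ 2 * m ≤ 1 :=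
        mul_le_one₀ (pow_le_one₀ hk.le (by linarith)) hm0.le hm1.le
      have h2 : (1 - m) * m ^ 2 ≤ 1 :=
        mul_le_one₀ (by linarith) (by positivity) (pow_le_one₀ hm0.le hm1.le)
      have h3 : 0 ≤ (1 - m) ^ 2 * m := by positivity
      have h4 : 0 ≤ (1 - m) * m ^ 2 := by positivity
      rw [abs_le]
      constructor <;> linarith
    · intro h2
      have hm2 : m ≤ 1 / 2 := by
        rw [hm, div_le_div_iff₀ hq0 (by norm_num)]
        linarith
      calc (1 : ℝ) / 8 = (1 / 2) ^ 3 := by norm_num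
        _ ≤ (1 - m) ^ 3 := pow_le_pow_left₀ (by norm_num) (by linarith) 3

/-- A cutoff whose first two derivatives are controlled by a fractional power of itself. -/
theorem exists_cutoff {p : ℝ} (hp : 1 < p) :
    ∃ (η η' η'' : ℝ → ℝ) (C : ℝ), 0 ≤ C ∧ (∀ t, HasDerivAt η (η' t) t) ∧
      (∀ t, HasDerivAt η' (η'' t) t) ∧ Continuous η'' ∧ (∀ t, 0 ≤ η t ∧ η t ≤ 1) ∧
      (∀ t, t ≤ 1 → η t = 1) ∧ (∀ t, t < 1 → η' t = 0 ∧ η'' t = 0) ∧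
      (∀ t, 4 ≤ t → η t = 0 ∧ η' t = 0 ∧ η'' t = 0) ∧
      ∀ t, |η' t| ≤ C * η t ^ (1 / p) ∧ |η'' t| ≤ C * η t ^ (1 / p) := by
  set θ : ℝ → ℝ := fun t => Real.smoothTransition ((4 - t) / 3) with hθ
  have hθc : ContDiff ℝ 3 θ := Real.smoothTransition.contDiff.comp (by fun_prop)
  have hθ'c : ContDiff ℝ 2 (deriv θ) :=
    ((contDiff_succ_iff_deriv (n := 2)).1 hθc).2.2
  have hθ''c : ContDiff ℝ 1 (deriv (deriv θ)) :=
    ((contDiff_succ_iff_deriv (n := 1)).1 hθ'c).2.2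
  have hd1 : ∀ t, HasDerivAt θ (deriv θ t) t := fun t =>
    ((hθc.differentiable (by norm_num)) t).hasDerivAt
  have hd2 : ∀ t, HasDerivAt (deriv θ) (deriv (deriv θ) t) t := fun t =>
    ((hθ'c.differentiable (by norm_num)) t).hasDerivAt
  have h0 : ∀ t, 0 ≤ θ t := fun t => Real.smoothTransition.nonneg _
  have h1 : ∀ t, θ t ≤ 1 := fun t => Real.smoothTransition.le_one _
  have hone : ∀ t, t ≤ 1 → θ t = 1 := fun t ht =>
    Real.smoothTransition.one_of_one_le (by linarith)
  have hzero : ∀ t, 4 ≤ t → θ t = 0 := fun t ht =>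
    Real.smoothTransition.zero_of_nonpos (by linarith)
  have hlt : ∀ t, t < 1 → deriv θ t = 0 ∧ deriv (deriv θ) t = 0 := by
    have hev : ∀ t, t < 1 → deriv θ t = 0 := fun t ht => by
      have : θ =ᶠ[𝓝 t] fun _ => 1 := by
        filter_upwards [Iio_mem_nhds ht] with s hs using hone s (le_of_lt hs)
      rw [this.deriv_eq, deriv_const]
    intro t ht
    refine ⟨hev t ht, ?_⟩
    have : deriv θ =ᶠ[𝓝 t] fun _ => 0 := by
      filter_upwards [Iio_mem_nhds ht] with s hs using hev s hs
    rw [this.deriv_eq, deriv_const]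
  obtain ⟨B1, hB1⟩ := (isCompact_Icc (a := (1 : ℝ)) (b := 4)).exists_bound_of_continuousOn
    hθ'c.continuous.continuousOn
  obtain ⟨B2, hB2⟩ := (isCompact_Icc (a := (1 : ℝ)) (b := 4)).exists_bound_of_continuousOn
    hθ''c.continuous.continuousOn
  simp only [Real.norm_eq_abs] at hB1 hB2
  have hB1' : 0 ≤ B1 := (abs_nonneg _).trans (hB1 1 (by norm_num))
  have hB2' : 0 ≤ B2 := (abs_nonneg _).trans (hB2 1 (by norm_num))
  obtain ⟨m, hm⟩ := exists_nat_ge (3 / (p - 1))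
  have hm' : 3 ≤ m * (p - 1) := (div_le_iff₀ (by linarith)).1 hm
  have hp0 : 0 < p := by linarith
  have hexp : (((m + 3 : ℕ) : ℝ)) * (1 / p) ≤ ((m + 1 : ℕ) : ℝ) := by
    rw [mul_one_div, div_le_iff₀ hp0]
    push_cast
    nlinarith
  have hpow : ∀ t, θ t ^ (m + 1) ≤ (θ t ^ (m + 3)) ^ (1 / p) := fun t => by
    rw [← Real.rpow_natCast, ← Real.rpow_natCast, ← Real.rpow_mul (h0 t)]
    rcases (h0 t).eq_or_lt with h | h
    · rw [← h, Real.zero_rpow (by positivity)]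
      positivity
    · exact Real.rpow_le_rpow_of_exponent_ge h (h1 t) hexp
  refine ⟨fun t => θ t ^ (m + 3), fun t => (m + 3) * θ t ^ (m + 2) * deriv θ t,
    fun t => (m + 3) * (m + 2) * θ t ^ (m + 1) * deriv θ t ^ 2 +
      (m + 3) * θ t ^ (m + 2) * deriv (deriv θ) t,
    (m + 3) * (m + 2) * B1 ^ 2 + (m + 3) * B1 + (m + 3) * B2, by positivity,
    ?_, ?_, ?_, ?_, ?_, ?_, ?_, ?_⟩
  · intro t
    refine ((hd1 t).pow (m + 3)).congr_deriv ?_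
    push_cast
    simp
  · intro t
    refine ((((hd1 t).pow (m + 2)).const_mul ((m : ℝ) + 3)).mul (hd2 t)).congr_deriv ?_
    simp only [Pi.pow_apply]
    push_cast
    ring
  · have := hθc.continuous
    have := hθ'c.continuous
    have := hθ''c.continuous
    fun_prop
  · exact fun t => ⟨pow_nonneg (h0 t) _, pow_le_one₀ (h0 t) (h1 t)⟩
  · intro t ht
    simp [hone t ht]
  · intro t ht
    simp [hlt t ht]
  · intro t ht
    simp [hzero t ht]
  · intro t
    have hle : θ t ^ (m + 2) ≤ θ t ^ (m + 1) :=
      pow_le_pow_of_le_one (h0 t) (h1 t) (by omega)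
    have hn : 0 ≤ θ t ^ (m + 1) := pow_nonneg (h0 t) _
    have hn2 : 0 ≤ θ t ^ (m + 2) := pow_nonneg (h0 t) _
    suffices H : |(m + 3) * θ t ^ (m + 2) * deriv θ t| ≤
        ((m + 3) * (m + 2) * B1 ^ 2 + (m + 3) * B1 + (m + 3) * B2) * θ t ^ (m + 1) ∧
        |(m + 3) * (m + 2) * θ t ^ (m + 1) * deriv θ t ^ 2 +
          (m + 3) * θ t ^ (m + 2) * deriv (deriv θ) t| ≤
        ((m + 3) * (m + 2) * B1 ^ 2 + (m + 3) * B1 + (m + 3) * B2) * θ t ^ (m + 1) by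
      exact ⟨H.1.trans (by gcongr; exact hpow t), H.2.trans (by gcongr; exact hpow t)⟩
    rcases lt_or_ge t 1 with ht | ht
    · simp only [hlt t ht]
      norm_num
      positivity
    rcases lt_or_ge 4 t with ht4 | ht4
    · simp [hzero t ht4.le]
    have b1 := hB1 t ⟨ht, ht4⟩
    have b2 := hB2 t ⟨ht, ht4⟩
    have c1 : |(m + 3) * θ t ^ (m + 2) * deriv θ t| ≤ (m + 3) * θ t ^ (m + 1) * B1 := by
      rw [abs_mul, abs_of_nonneg (by positivity)]
      gcongr
    have c2 : |(m + 3) * θ t ^ (m + 2) * deriv (deriv θ) t| ≤ (m + 3) * θ t ^ (m + 1) * B2 := by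
      rw [abs_mul, abs_of_nonneg (by positivity)]
      gcongr
    have c3 : |(m + 3) * (m + 2) * θ t ^ (m + 1) * deriv θ t ^ 2| ≤
        (m + 3) * (m + 2) * θ t ^ (m + 1) * B1 ^ 2 := by
      rw [abs_mul, abs_of_nonneg (by positivity), abs_pow]
      gcongr
    have d1 : 0 ≤ (m + 3) * (m + 2) * B1 ^ 2 * θ t ^ (m + 1) := by positivity
    have d2 : 0 ≤ (m + 3) * B1 * θ t ^ (m + 1) := by positivity
    have d3 : 0 ≤ (m + 3) * B2 * θ t ^ (m + 1) := by positivity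
    refine ⟨c1.trans (by linarith), (abs_add_le _ _).trans ((add_le_add c3 c2).trans ?_)⟩
    linarith

/-- Crude form of Young's inequality with a parameter. -/
theorem mul_le_rpow_add_rpow {p M y z : ℝ} (hp : 1 < p) (hM : 0 < M) (hy : 0 ≤ y) (hz : 0 ≤ z) :
    y * z ≤ M * y ^ p + M ^ (-(1 / (p - 1))) * z ^ (1 + 1 / (p - 1)) := by
  have hp1 : 0 < p - 1 := by linarith
  rcases hy.eq_or_lt with rfl | hy'
  · rw [zero_mul]
    positivity
  rcases le_total z (M * y ^ (p - 1)) with h | h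
  · have e : y ^ p = y * y ^ (p - 1) := by
      rw [Real.rpow_sub_one hy'.ne']
      field_simp
    have h1 : y * z ≤ M * y ^ p := by
      rw [e]
      nlinarith
    have h2 : 0 ≤ M ^ (-(1 / (p - 1))) * z ^ (1 + 1 / (p - 1)) := by positivity
    linarith
  · have hz' : 0 < z := lt_of_lt_of_le (by positivity) h
    have h1 : y ≤ M ^ (-(1 / (p - 1))) * z ^ (1 / (p - 1)) := by
      have h3 : y ^ (p - 1) ≤ M⁻¹ * z := by
        rw [inv_mul_eq_div, le_div_iff₀ hM]
        linarith
      have h4 := Real.rpow_le_rpow (by positivity) h3 (z := 1 / (p - 1)) (by positivity)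
      rw [← Real.rpow_mul hy, mul_one_div_cancel hp1.ne', Real.rpow_one,
        Real.mul_rpow (by positivity) hz, Real.inv_rpow hM.le, ← Real.rpow_neg hM.le] at h4
      exact h4
    have h2 : z ^ (1 + 1 / (p - 1)) = z * z ^ (1 / (p - 1)) := by
      rw [Real.rpow_add hz', Real.rpow_one]
    have h3 : 0 ≤ M * y ^ p := by positivity
    rw [h2]
    nlinarith

/-- A monotone sequence with `I 0 > 0` cannot be controlled by its increments up to an error
decaying in the weight `M`. -/
theorem false_of_monotone_of_forall_le {I : ℕ → ℝ} (hI : Monotone I) (h0 : 0 < I 0) {E s : ℝ}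
    (hs : 0 < s)
    (h : ∀ M, 0 < M → ∀ k, I (k + 1) ≤ M * (I (k + 1) - I k) + E * M ^ (-s)) : False := by
  have hb : BddAbove (Set.range I) := by
    refine ⟨2 * (E * (1 / 2) ^ (-s)), ?_⟩
    rintro _ ⟨k, rfl⟩
    have h1 := h (1 / 2) (by norm_num) k
    have h2 := hI (Nat.zero_le k)
    have h3 := hI (Nat.le_succ k)
    simp only [Nat.succ_eq_add_one] at h3
    linarith
  have hL := tendsto_atTop_ciSup hI hb
  set L := ⨆ i, I i
  have hL0 : I 0 ≤ L := le_ciSup hb 0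
  have hL' : Tendsto (fun k => I (k + 1)) atTop (𝓝 L) := hL.comp (tendsto_add_atTop_nat 1)
  have h1 : ∀ M, 0 < M → L ≤ E * M ^ (-s) := fun M hM => by
    have := le_of_tendsto_of_tendsto' hL'
      (((hL'.sub hL).const_mul M).add_const (E * M ^ (-s))) (h M hM)
    simpa using this
  have h2 : Tendsto (fun M : ℝ => E * M ^ (-s)) atTop (𝓝 (E * 0)) :=
    (tendsto_rpow_neg_atTop hs).const_mul E
  have h3 : L ≤ E * 0 := ge_of_tendsto h2 (by
    filter_upwards [eventually_gt_atTop 0] with M hM using h1 M hM)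
  linarith

/-- A function with a continuous second derivative is `C²`. -/
theorem contDiff_two_of_hasDerivAt {f f' f'' : ℝ → ℝ} (h1 : ∀ t, HasDerivAt f (f' t) t)
    (h2 : ∀ t, HasDerivAt f' (f'' t) t) (hc : Continuous f'') : ContDiff ℝ 2 f := by
  have e1 : deriv f = f' := funext fun t => (h1 t).deriv
  have e2 : deriv f' = f'' := funext fun t => (h2 t).deriv
  have hf' : ContDiff ℝ 1 f' :=
    contDiff_one_iff_deriv.2 ⟨fun t => (h2 t).differentiableAt, by rwa [e2]⟩
  exact (contDiff_succ_iff_deriv (n := 1)).2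
    ⟨fun t => (h1 t).differentiableAt, by simp, by rwa [e1]⟩

/-- Bound, on the annulus where the cutoff varies, for minus the Laplacian of the test function,
in terms of the values of the one-variable profiles and their derivatives. -/
theorem annulus_bound {n A A'' T b b' b'' e e' e'' E C q Q : ℝ} (hn : 0 ≤ n) (hQ : 0 < Q)
    (hQq : Q ≤ q) (hqQ : q ≤ 4 * Q) (hA : 0 ≤ A) (hA'' : 0 ≤ A'') (hT : 0 ≤ T) (hTA : T ≤ 3 * A)
    (hb : 0 ≤ b) (hb1 : b ≤ 1) (hb' : 0 ≤ b') (hqb' : q * b' ≤ 3) (hqb'' : q ^ 2 * |b''| ≤ 12)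
    (he : 0 ≤ e) (heE : e ≤ E) (hC : 0 ≤ C) (he' : |e'| ≤ C * E) (he'' : |e''| ≤ C * E) :
    -(A'' * (b * e) + 4 * T * (b' * e + b * (e' / Q)) +
      A * (4 * q * (b'' * e + 2 * (b' * (e' / Q)) + b * (e'' / Q ^ 2)) +
        2 * n * (b' * e + b * (e' / Q)))) ≤
      ((12 + 2 * n) * (3 + C) + 16 * (12 + 7 * C)) / Q * (A * E) := by
  have hE : 0 ≤ E := he.trans heE
  have hb'Q : b' ≤ 3 / Q := by
    rw [le_div_iff₀ hQ]
    nlinarith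
  have hb''Q : |b''| ≤ 12 / Q ^ 2 := by
    rw [le_div_iff₀ (by positivity)]
    have : Q ^ 2 ≤ q ^ 2 := by gcongr
    nlinarith [abs_nonneg b'']
  have k1 : |b' * e + b * (e' / Q)| ≤ (3 + C) * E / Q := by
    calc |b' * e + b * (e' / Q)| ≤ |b' * e| + |b * (e' / Q)| := abs_add_le _ _
      _ = b' * e + b * (|e'| / Q) := by
        rw [abs_mul, abs_mul, abs_div, abs_of_nonneg hb', abs_of_nonneg he, abs_of_nonneg hb,
          abs_of_pos hQ]
      _ ≤ 3 / Q * E + 1 * (C * E / Q) := by gcongr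
      _ = (3 + C) * E / Q := by ring
  have k2 : |b'' * e + 2 * (b' * (e' / Q)) + b * (e'' / Q ^ 2)| ≤ (12 + 7 * C) * E / Q ^ 2 := by
    calc |b'' * e + 2 * (b' * (e' / Q)) + b * (e'' / Q ^ 2)|
        ≤ |b'' * e| + |2 * (b' * (e' / Q))| + |b * (e'' / Q ^ 2)| :=
          (abs_add_le _ _).trans (by gcongr; exact abs_add_le _ _)
      _ = |b''| * e + 2 * (b' * (|e'| / Q)) + b * (|e''| / Q ^ 2) := by
        simp only [abs_mul, abs_div, abs_of_nonneg hb', abs_of_nonneg he, abs_of_nonneg hb,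
          abs_of_pos hQ, abs_of_pos (pow_pos hQ 2), abs_two]
      _ ≤ 12 / Q ^ 2 * E + 2 * (3 / Q * (C * E / Q)) + 1 * (C * E / Q ^ 2) := by gcongr
      _ = (12 + 7 * C) * E / Q ^ 2 := by
        field_simp
        ring
  set β' := b' * e + b * (e' / Q)
  set β'' := b'' * e + 2 * (b' * (e' / Q)) + b * (e'' / Q ^ 2)
  have j1 : -(4 * T * β') ≤ 4 * (3 * A) * ((3 + C) * E / Q) := by
    calc -(4 * T * β') = 4 * T * (-β') := by ring
      _ ≤ 4 * T * ((3 + C) * E / Q) := by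
        gcongr
        exact (neg_le_abs _).trans k1
      _ ≤ 4 * (3 * A) * ((3 + C) * E / Q) := by gcongr
  have j2 : -(A * (2 * n * β')) ≤ A * (2 * n * ((3 + C) * E / Q)) := by
    rw [← mul_neg, ← mul_neg]
    gcongr
    exact (neg_le_abs _).trans k1
  have j3 : -(A * (4 * q * β'')) ≤ A * (4 * (4 * Q) * ((12 + 7 * C) * E / Q ^ 2)) := by
    have hq : 0 < q := hQ.trans_le hQq
    calc -(A * (4 * q * β'')) = A * (4 * q * (-β'')) := by ring
      _ ≤ A * (4 * q * ((12 + 7 * C) * E / Q ^ 2)) := by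
        gcongr
        exact (neg_le_abs _).trans k2
      _ ≤ A * (4 * (4 * Q) * ((12 + 7 * C) * E / Q ^ 2)) := by gcongr
  have j4 : 0 ≤ A'' * (b * e) := by positivity
  have j5 : ((12 + 2 * n) * (3 + C) + 16 * (12 + 7 * C)) / Q * (A * E) =
      4 * (3 * A) * ((3 + C) * E / Q) + A * (2 * n * ((3 + C) * E / Q)) +
        A * (4 * (4 * Q) * ((12 + 7 * C) * E / Q ^ 2)) := by
    field_simp
    ring
  rw [j5]
  linarith

/-- Under the scaling relation `N + 1 ≤ 2 (1 + s)`, the volume factor of order `R ^ (N + 1)` is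
compensated by the decay `(R ^ 2) ^ (-(1 + s))`. -/
theorem scaled_volume_mul_le {N : ℕ} {R D V m s : ℝ} (hR : 1 ≤ R) (hD : 0 ≤ D) (hV : 0 ≤ V)
    (hm : 0 ≤ m) (hcrit : (N : ℝ) + 1 ≤ 2 * (1 + s)) :
    (2 * R) ^ N * V * (m * (D / R ^ 2) ^ (1 + s) * (2 * R)) ≤
      D ^ (1 + s) * 2 ^ (N + 1) * V * m := by
  have hR0 : 0 < R := by linarith
  have hpow : R ^ (N + 1) ≤ (R ^ 2) ^ (1 + s) := by
    rw [← Real.rpow_natCast R (N + 1), ← Real.rpow_natCast R 2, ← Real.rpow_mul hR0.le]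
    refine Real.rpow_le_rpow_of_exponent_le hR ?_
    push_cast
    exact hcrit
  calc (2 * R) ^ N * V * (m * (D / R ^ 2) ^ (1 + s) * (2 * R))
      = D ^ (1 + s) * 2 ^ (N + 1) * V * m * (R ^ (N + 1) / (R ^ 2) ^ (1 + s)) := by
        rw [Real.div_rpow hD (by positivity)]
        ring
    _ ≤ D ^ (1 + s) * 2 ^ (N + 1) * V * m :=
        mul_le_of_le_one_right (by positivity) ((div_le_one (by positivity)).2 hpow)

set_option maxHeartbeats 1000000 in
/-- At or below the critical exponent there is no globally `C²` function which, on the part of the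
closed half-space outside a ball, is a positive supersolution of `-Δu = u ^ p`. -/
theorem no_global_supersolution {N : ℕ} (hN : 2 ≤ N) (j : Fin N) {p r : ℝ} (hp : 1 < p)
    (hcrit : (N : ℝ) + 1 ≤ 2 * (1 + 1 / (p - 1))) (hr : 0 < r)
    {v : EuclideanSpace ℝ (Fin N) → ℝ} (hv : ContDiff ℝ 2 v)
    (hsuper : ∀ x : EuclideanSpace ℝ (Fin N), 0 ≤ x j → r ≤ ‖x‖ ^ 2 →
      0 < v x ∧ v x ^ p ≤ -lap v x) : False := by
  obtain ⟨a, a', a'', ha, ha', ha''c, ha0, hapos⟩ := exists_convex_ramp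
  obtain ⟨b, b', b'', hb, hb', hb''c, hb0, hbpos⟩ := exists_radial_profile hN hr
  obtain ⟨η, η', η'', C, hC, hη, hη', hη''c, hη01, hη1, hηlt, hη4, hηC⟩ := exists_cutoff hp
  have hp0 : 0 < p := by linarith
  have hp1 : 0 < p - 1 := by linarith
  have hae : ∀ t, 0 ≤ a t := fun t => (le_or_gt t 0).elim (fun h => (ha0 t h).1.ge)
    fun h => (hapos t h).1.le
  have hbe : ∀ q, 0 ≤ b q := fun q => (le_or_gt q r).elim (fun h => (hb0 q h).1.ge)
    fun h => (hbpos q h).1.le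
  -- the test function at scale `R`
  set φ : ℝ → EuclideanSpace ℝ (Fin N) → ℝ :=
    fun R x => a (x j) * (fun q => b q * η (q / R ^ 2)) (‖x‖ ^ 2) with hφ
  have hφ_nonneg : ∀ R x, 0 ≤ φ R x := fun R x =>
    mul_nonneg (hae _) (mul_nonneg (hbe _) (hη01 _).1)
  have hφ_zero : ∀ R x, (x j ≤ 0 ∨ ‖x‖ ^ 2 ≤ r) → φ R x = 0 := by
    rintro R x (h | h)
    · simp [hφ, (ha0 _ h).1]
    · simp [hφ, (hb0 _ h).1]
  have hcoord : ContDiff ℝ 2 fun x : EuclideanSpace ℝ (Fin N) => x j :=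
    (EuclideanSpace.proj (𝕜 := ℝ) j).contDiff
  have hφ_contDiff : ∀ R, ContDiff ℝ 2 (φ R) := fun R =>
    ((contDiff_two_of_hasDerivAt ha ha' ha''c).comp hcoord).mul
      (((contDiff_two_of_hasDerivAt hb hb' hb''c).mul
        ((contDiff_two_of_hasDerivAt hη hη' hη''c).comp (contDiff_id.div_const _))).comp
        (contDiff_norm_sq ℝ))
  have hfar : ∀ R, 0 < R → ∀ x : EuclideanSpace ℝ (Fin N), 2 * R < ‖x‖ →
      4 ≤ ‖x‖ ^ 2 / R ^ 2 := fun R hR x hx => by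
    rw [le_div_iff₀ (by positivity)]
    nlinarith
  have hφ_supp : ∀ R, 0 < R → HasCompactSupport (φ R) := fun R hR => by
    refine HasCompactSupport.intro (isCompact_closedBall 0 (2 * R)) fun x hx => ?_
    rw [mem_closedBall_zero_iff, not_le] at hx
    simp [hφ, (hη4 _ (hfar R hR x hx)).1]
  have hlap : ∀ R x, lap (φ R) x =
      a'' (x j) * (b (‖x‖ ^ 2) * η (‖x‖ ^ 2 / R ^ 2)) +
      4 * (x j * a' (x j)) * (b' (‖x‖ ^ 2) * η (‖x‖ ^ 2 / R ^ 2) +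
        b (‖x‖ ^ 2) * (η' (‖x‖ ^ 2 / R ^ 2) / R ^ 2)) +
      a (x j) * (4 * ‖x‖ ^ 2 * (b'' (‖x‖ ^ 2) * η (‖x‖ ^ 2 / R ^ 2) +
        2 * (b' (‖x‖ ^ 2) * (η' (‖x‖ ^ 2 / R ^ 2) / R ^ 2)) +
        b (‖x‖ ^ 2) * (η'' (‖x‖ ^ 2 / R ^ 2) / (R ^ 2) ^ 2)) +
        2 * N * (b' (‖x‖ ^ 2) * η (‖x‖ ^ 2 / R ^ 2) +
        b (‖x‖ ^ 2) * (η' (‖x‖ ^ 2 / R ^ 2) / R ^ 2))) := fun R x => by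
    have d1 : ∀ q, HasDerivAt (fun q => η (q / R ^ 2)) (η' (q / R ^ 2) / R ^ 2) q := fun q =>
      ((hη (q / R ^ 2)).comp q ((hasDerivAt_id q).div_const (R ^ 2))).congr_deriv
        (by simp [div_eq_mul_inv])
    have d2 : ∀ q, HasDerivAt (fun q => η' (q / R ^ 2) / R ^ 2)
        (η'' (q / R ^ 2) / (R ^ 2) ^ 2) q := fun q =>
      (((hη' (q / R ^ 2)).comp q ((hasDerivAt_id q).div_const (R ^ 2))).div_const
        (R ^ 2)).congr_deriv (by simp only [div_eq_mul_inv, one_mul, mul_assoc, sq, mul_inv])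
    refine lap_coord_mul_radial j x ha (ha' _) (β := fun q => b q * η (q / R ^ 2))
      (β' := fun q => b' q * η (q / R ^ 2) + b q * (η' (q / R ^ 2) / R ^ 2))
      (.of_forall fun q => (hb q).mul (d1 q)) ?_
    refine (((hb' _).mul (d1 _)).add ((hb _).mul (d2 _))).congr_deriv ?_
    ring
  have hvp : Continuous fun x => v x ^ p := hv.continuous.rpow_const fun _ => Or.inr hp0.le
  have hint : ∀ R, 0 < R → Integrable fun x => φ R x * v x ^ p := fun R hR =>
    ((hφ_contDiff R).continuous.mul hvp).integrable_of_hasCompactSupport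
      (hφ_supp R hR).mul_right
  have hg_nonneg : ∀ R x, 0 ≤ φ R x * v x ^ p := fun R x => by
    by_cases h : x j ≤ 0 ∨ ‖x‖ ^ 2 ≤ r
    · simp [hφ_zero R x h]
    · push Not at h
      have := (hsuper x h.1.le h.2.le).1
      exact mul_nonneg (hφ_nonneg R x) (by positivity)
  have hg_mono : ∀ R, 0 < R → ∀ x, φ (R / 2) x * v x ^ p ≤ φ R x * v x ^ p := fun R hR x => by
    by_cases h : x j ≤ 0 ∨ ‖x‖ ^ 2 ≤ r
    · simp [hφ_zero _ x h]
    push Not at h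
    have hv0 := (hsuper x h.1.le h.2.le).1
    have hη2 : η (‖x‖ ^ 2 / (R / 2) ^ 2) ≤ η (‖x‖ ^ 2 / R ^ 2) := by
      have e : ‖x‖ ^ 2 / (R / 2) ^ 2 = 4 * (‖x‖ ^ 2 / R ^ 2) := by
        field_simp
        ring
      rcases le_total (‖x‖ ^ 2 / R ^ 2) 1 with h1 | h1
      · rw [hη1 _ h1]
        exact (hη01 _).2
      · rw [e, (hη4 _ (by linarith)).1]
        exact (hη01 _).1
    simp only [hφ]
    have := hae (x j)
    have := hbe (‖x‖ ^ 2)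
    gcongr
  set s : ℝ := 1 / (p - 1) with hs
  have hs0 : 0 < s := by positivity
  set D : ℝ := 8 * ((12 + 2 * N) * (3 + C) + 16 * (12 + 7 * C)) with hD
  have hD0 : 0 ≤ D := by positivity
  -- pointwise estimate
  have hpt : ∀ M, 0 < M → ∀ R, 0 < R → 2 * r ≤ R ^ 2 → ∀ x, v x * -lap (φ R) x ≤
      M * (φ R x * v x ^ p - φ (R / 2) x * v x ^ p) +
        (Metric.closedBall (0 : EuclideanSpace ℝ (Fin N)) (2 * R)).indicator
          (fun _ => M ^ (-s) * (D / R ^ 2) ^ (1 + s) * (2 * R)) x := by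
    intro M hM R hR hRr x
    have hK0 : 0 ≤ M ^ (-s) * (D / R ^ 2) ^ (1 + s) * (2 * R) := by positivity
    have hi0 : 0 ≤ (Metric.closedBall (0 : EuclideanSpace ℝ (Fin N)) (2 * R)).indicator
          (fun _ => M ^ (-s) * (D / R ^ 2) ^ (1 + s) * (2 * R)) x :=
      Set.indicator_nonneg (fun _ _ => hK0) x
    have hm0 : 0 ≤ M * (φ R x * v x ^ p - φ (R / 2) x * v x ^ p) :=
      mul_nonneg hM.le (sub_nonneg.2 (hg_mono R hR x))
    rcases le_or_gt (x j) 0 with hxj | hxj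
    · have : lap (φ R) x = 0 := by
        obtain ⟨h1, h2, h3⟩ := ha0 _ hxj
        rw [hlap, h1, h2, h3]
        ring
      rw [this]
      linarith
    rcases le_or_gt (‖x‖ ^ 2) r with hxr | hxr
    · have : lap (φ R) x = 0 := by
        obtain ⟨h1, h2, h3⟩ := hb0 _ hxr
        rw [hlap, h1, h2, h3]
        ring
      rw [this]
      linarith
    have hv0 : 0 < v x := (hsuper x hxj.le hxr.le).1
    obtain ⟨hA0, hAt, hA'', hAT, hTA⟩ := hapos _ hxj
    obtain ⟨hB0, hB1, hB', hBsub, hqB', hqB'', hB8⟩ := hbpos _ hxr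
    rcases lt_or_ge (‖x‖ ^ 2) (R ^ 2) with hxR | hxR
    · have hlt : ‖x‖ ^ 2 / R ^ 2 < 1 := (div_lt_one (by positivity)).2 hxR
      have h0 : 0 ≤ lap (φ R) x := by
        rw [hlap, (hηlt _ hlt).1, (hηlt _ hlt).2, hη1 _ hlt.le]
        have e1 : 0 ≤ a'' (x j) * b (‖x‖ ^ 2) := by positivity
        have e2 : 0 ≤ (x j * a' (x j) - a (x j)) * b' (‖x‖ ^ 2) :=
          mul_nonneg (by linarith) hB'
        have e3 := mul_nonneg hA0.le hBsub
        ring_nf at e1 e2 e3 ⊢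
        linarith
      have : 0 ≤ v x * lap (φ R) x := by positivity
      linarith
    rcases lt_or_ge (2 * R) ‖x‖ with hxR2 | hxR2
    · have : lap (φ R) x = 0 := by
        obtain ⟨h1, h2, h3⟩ := hη4 _ (hfar R hR x hxR2)
        rw [hlap, h1, h2, h3]
        ring
      rw [this]
      linarith
    set q := ‖x‖ ^ 2 with hq
    set E := η (q / R ^ 2) ^ (1 / p) with hE
    have hη0 := (hη01 (q / R ^ 2)).1
    have hηE : η (q / R ^ 2) ≤ E := by
      rcases hη0.eq_or_lt with h | h
      · rw [← h]
        positivity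
      · calc η (q / R ^ 2) = η (q / R ^ 2) ^ (1 : ℝ) := (Real.rpow_one _).symm
          _ ≤ E := Real.rpow_le_rpow_of_exponent_ge h (hη01 _).2
            ((div_le_one hp0).2 hp.le)
    have hq4 : q ≤ 4 * R ^ 2 := by
      rw [hq]
      nlinarith [norm_nonneg x]
    have hbound := annulus_bound (n := N) (b'' := b'' q) (e' := η' (q / R ^ 2))
      (e'' := η'' (q / R ^ 2)) (by positivity)
      (show (0 : ℝ) < R ^ 2 by positivity) hxR hq4 hA0.le hA'' (hA0.le.trans hAT) hTA hB0.le hB1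
      hB' hqB' hqB'' hη0 hηE hC (hηC _).1 (hηC _).2
    rw [← hlap] at hbound
    set y := (b q * η (q / R ^ 2)) ^ (1 / p) with hy
    have hE8 : E ≤ 8 * y := by
      have h8 : (1 : ℝ) ≤ 8 * b q ^ (1 / p) := by
        have h1 : b q ≤ b q ^ (1 / p) := by
          calc b q = b q ^ (1 : ℝ) := (Real.rpow_one _).symm
            _ ≤ _ := Real.rpow_le_rpow_of_exponent_ge hB0 hB1 ((div_le_one hp0).2 hp.le)
        have h2 := hB8 (hRr.trans hxR)
        linarith
      have hE0 : 0 ≤ E := by positivity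
      rw [hy, Real.mul_rpow hB0.le hη0]
      nlinarith
    have hbound' : -lap (φ R) x ≤ a (x j) * (y * (D / R ^ 2)) := by
      refine hbound.trans ?_
      calc _ ≤ ((12 + 2 * N) * (3 + C) + 16 * (12 + 7 * C)) / R ^ 2 * (a (x j) * (8 * y)) := by
            gcongr
        _ = a (x j) * (y * (D / R ^ 2)) := by
            rw [hD]
            ring
    have hyp : y ^ p = b q * η (q / R ^ 2) := by
      rw [hy, ← Real.rpow_mul (by positivity), one_div_mul_cancel hp0.ne', Real.rpow_one]
    have hyoung := mul_le_rpow_add_rpow hp hM (y := v x * y) (z := D / R ^ 2) (by positivity)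
      (by positivity)
    rw [← hs, Real.mul_rpow hv0.le (by positivity), hyp] at hyoung
    have hφ2 : φ (R / 2) x = 0 := by
      have e : q / (R / 2) ^ 2 = 4 * (q / R ^ 2) := by
        field_simp
        ring
      have h1 : 1 ≤ q / R ^ 2 := (one_le_div (by positivity)).2 hxR
      simp only [hφ, ← hq]
      rw [e, (hη4 _ (by linarith)).1]
      ring
    have hxle : x j ≤ 2 * R :=
      (le_abs_self _).trans ((PiLp.norm_apply_le x j).trans hxR2)
    rw [Set.indicator_of_mem (mem_closedBall_zero_iff.2 hxR2), hφ2]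
    have hz : 0 ≤ M ^ (-s) * (D / R ^ 2) ^ (1 + s) := by positivity
    calc v x * -lap (φ R) x ≤ v x * (a (x j) * (y * (D / R ^ 2))) := by gcongr
      _ = a (x j) * (v x * y * (D / R ^ 2)) := by ring
      _ ≤ a (x j) * (M * (v x ^ p * (b q * η (q / R ^ 2))) +
          M ^ (-s) * (D / R ^ 2) ^ (1 + s)) := by gcongr
      _ = M * (φ R x * v x ^ p - 0 * v x ^ p) + M ^ (-s) * (D / R ^ 2) ^ (1 + s) * a (x j) := by
        simp only [hφ, ← hq]
        ring
      _ ≤ _ := by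
        gcongr
        exact hAt.trans hxle
  -- integrated estimate
  set V : ℝ := (volume : Measure (EuclideanSpace ℝ (Fin N))).real (Metric.ball 0 1) with hV
  have hstep : ∀ M, 0 < M → ∀ R, 1 ≤ R → 2 * r ≤ R ^ 2 →
      ∫ x, φ R x * v x ^ p ≤
        M * ((∫ x, φ R x * v x ^ p) - ∫ x, φ (R / 2) x * v x ^ p) +
          D ^ (1 + s) * 2 ^ (N + 1) * V * M ^ (-s) := by
    intro M hM R hR1 hRr
    have hR : 0 < R := by linarith
    obtain ⟨i1, i2, hgreen⟩ := integral_mul_lap_comm (hφ_contDiff R) (hφ_supp R hR) hv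
    have hfin : volume (Metric.closedBall (0 : EuclideanSpace ℝ (Fin N)) (2 * R)) ≠ ⊤ :=
      measure_closedBall_lt_top.ne
    have hi : Integrable ((Metric.closedBall (0 : EuclideanSpace ℝ (Fin N)) (2 * R)).indicator
        (fun _ => M ^ (-s) * (D / R ^ 2) ^ (1 + s) * (2 * R))) :=
      (integrableOn_const hfin).integrable_indicator measurableSet_closedBall
    have hdiff : Integrable fun x => φ R x * v x ^ p - φ (R / 2) x * v x ^ p :=
      (hint R hR).sub (hint (R / 2) (by positivity))
    have hvol : (volume : Measure (EuclideanSpace ℝ (Fin N))).real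
        (Metric.closedBall 0 (2 * R)) = (2 * R) ^ N * V := by
      rw [Measure.addHaar_real_closedBall _ _ (by positivity), finrank_euclideanSpace_fin]
    calc ∫ x, φ R x * v x ^ p ≤ ∫ x, -(φ R x * lap v x) := by
          refine integral_mono (hint R hR) i1.neg fun x => ?_
          simp only
          by_cases h : x j ≤ 0 ∨ ‖x‖ ^ 2 ≤ r
          · simp [hφ_zero R x h]
          · push Not at h
            rw [← mul_neg]
            exact mul_le_mul_of_nonneg_left (hsuper x h.1.le h.2.le).2 (hφ_nonneg R x)
      _ = ∫ x, v x * -lap (φ R) x := by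
          simp only [mul_neg]
          rw [integral_neg, integral_neg, hgreen]
      _ ≤ ∫ x, (M * (φ R x * v x ^ p - φ (R / 2) x * v x ^ p) +
          (Metric.closedBall (0 : EuclideanSpace ℝ (Fin N)) (2 * R)).indicator
            (fun _ => M ^ (-s) * (D / R ^ 2) ^ (1 + s) * (2 * R)) x) :=
          integral_mono (by simp only [mul_neg]; exact i2.neg) ((hdiff.const_mul M).add hi)
            (hpt M hM R hR hRr)
      _ = M * ((∫ x, φ R x * v x ^ p) - ∫ x, φ (R / 2) x * v x ^ p) +
          (2 * R) ^ N * V * (M ^ (-s) * (D / R ^ 2) ^ (1 + s) * (2 * R)) := by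
          rw [integral_add (hdiff.const_mul M) hi, integral_const_mul,
            integral_sub (hint R hR) (hint (R / 2) (by positivity)),
            integral_indicator measurableSet_closedBall, setIntegral_const, hvol, smul_eq_mul]
      _ ≤ _ := by
          have hV0 : 0 ≤ V := measureReal_nonneg
          exact add_le_add_right (scaled_volume_mul_le hR1 hD0 hV0 (by positivity) hcrit) _
  set R₀ : ℝ := 1 + 2 * r with hR₀
  have hscale : ∀ k : ℕ, 2 ^ (k + 1) * R₀ / 2 = 2 ^ k * R₀ := fun k => by ring
  have hR₀1 : 1 ≤ R₀ := by linarith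
  have hR₀r : 2 * r ≤ R₀ ^ 2 := by nlinarith
  have hRk : ∀ k : ℕ, R₀ ≤ 2 ^ k * R₀ := fun k =>
    le_mul_of_one_le_left (by positivity) (one_le_pow₀ (by norm_num))
  refine false_of_monotone_of_forall_le (I := fun k : ℕ => ∫ x, φ (2 ^ k * R₀) x * v x ^ p)
    (E := D ^ (1 + s) * 2 ^ (N + 1) * V) (s := s) ?_ ?_ hs0 ?_
  · refine monotone_nat_of_le_succ fun k => ?_
    have hpos : 0 < 2 ^ (k + 1) * R₀ := by positivity
    refine integral_mono (hint _ (by positivity)) (hint _ hpos) fun x => ?_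
    have := hg_mono _ hpos x
    rwa [hscale] at this
  · have hR₀0 : 0 < R₀ := by positivity
    simp only [pow_zero, one_mul]
    refine ((hφ_contDiff R₀).continuous.mul hvp).integral_pos_of_hasCompactSupport_nonneg_nonzero
      (hφ_supp R₀ hR₀0).mul_right (hg_nonneg R₀) (x := EuclideanSpace.single j R₀) ?_
    have hxj : (EuclideanSpace.single j R₀ : EuclideanSpace ℝ (Fin N)) j = R₀ := by simp
    have hxn : ‖(EuclideanSpace.single j R₀ : EuclideanSpace ℝ (Fin N))‖ ^ 2 = R₀ ^ 2 := by simp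
    have hv0 := (hsuper (EuclideanSpace.single j R₀) (by rw [hxj]; exact hR₀0.le)
      (by rw [hxn]; linarith)).1
    have h1 := (hapos _ hR₀0).1
    have h2 := (hbpos (R₀ ^ 2) (by linarith)).1
    simp only [hφ]
    rw [hxj, hxn, div_self (by positivity), hη1 1 le_rfl]
    positivity
  · intro M hM k
    have h := hstep M hM (2 ^ (k + 1) * R₀) (hR₀1.trans (hRk _))
      (hR₀r.trans (by have := hRk (k + 1); gcongr))
    rwa [hscale] at h

/-- The explicit supersolution `c x_j ‖x‖^(-s)` with `s = (p + 1) / (p - 1)`. -/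
theorem exists_supersolution {N : ℕ} (j : Fin N) {p : ℝ} (hp : 1 < p)
    (hs : (p + 1) / (p - 1) < N) :
    ∃ u : EuclideanSpace ℝ (Fin N) → ℝ, ContDiffOn ℝ 2 u {x | x ≠ 0} ∧
      ∀ x : EuclideanSpace ℝ (Fin N), 0 < x j → 0 < u x ∧ u x ^ p ≤ -lap u x := by
  have hp1 : 0 < p - 1 := by linarith
  obtain ⟨s, hsdef⟩ : ∃ s, s = (p + 1) / (p - 1) := ⟨_, rfl⟩
  rw [← hsdef] at hs
  have hsp : s * (p - 1) = p + 1 := by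
    rw [hsdef]
    field_simp
  have hs0 : 0 < s := by
    rw [hsdef]
    positivity
  have hκ : 0 < s * (N - s) := mul_pos hs0 (by linarith)
  set c : ℝ := (s * (N - s)) ^ (1 / (p - 1)) with hc
  have hc0 : 0 < c := by positivity
  have hcp : c ^ (p - 1) = s * (N - s) := by
    rw [hc, ← Real.rpow_mul hκ.le, one_div_mul_cancel hp1.ne', Real.rpow_one]
  refine ⟨fun x => (fun t => c * t) (x j) * (fun q : ℝ => q ^ (-s / 2)) (‖x‖ ^ 2), ?_, ?_⟩
  · intro x hx
    have hx' : ‖x‖ ^ 2 ≠ 0 := by simpa using hx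
    refine ContDiffAt.contDiffWithinAt (ContDiffAt.mul ?_ ?_)
    · exact contDiffAt_const.mul (EuclideanSpace.proj (𝕜 := ℝ) j).contDiff.contDiffAt
    · exact (contDiff_norm_sq ℝ).contDiffAt.rpow_const_of_ne hx'
  · intro x hxj
    have hx0 : 0 < ‖x‖ := norm_pos_iff.2 fun h => by simp [h] at hxj
    set q := ‖x‖ ^ 2 with hq
    have hq0 : 0 < q := by positivity
    have hlap := lap_coord_mul_radial j (a := fun t => c * t) (a' := fun _ => c) (a'' := 0)
      (β := fun q : ℝ => q ^ (-s / 2)) (β' := fun q => -s / 2 * q ^ (-s / 2 - 1))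
      (β'' := -s / 2 * ((-s / 2 - 1) * q ^ (-s / 2 - 1 - 1))) x
      (fun t => ((hasDerivAt_id t).const_mul c).congr_deriv (by ring)) (hasDerivAt_const _ _)
      (by
        filter_upwards [lt_mem_nhds hq0] with q' hq'
        exact Real.hasDerivAt_rpow_const (Or.inl (ne_of_gt hq')))
      ((Real.hasDerivAt_rpow_const (Or.inl hq0.ne')).const_mul _)
    rw [hlap]
    simp only [← hq]
    refine ⟨by positivity, ?_⟩
    have hq1 : q ^ (-s / 2 - 1 - 1) * q = q ^ (-s / 2 - 1) := by
      rw [Real.rpow_sub_one hq0.ne' (-s / 2 - 1)]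
      field_simp
    have hrhs : -(0 * q ^ (-s / 2) + 4 * (x j * c) * (-s / 2 * q ^ (-s / 2 - 1)) +
        c * x j * (4 * q * (-s / 2 * ((-s / 2 - 1) * q ^ (-s / 2 - 1 - 1))) +
          2 * N * (-s / 2 * q ^ (-s / 2 - 1)))) =
        c * x j * (s * (N - s)) * q ^ (-s / 2 - 1) := by
      rw [← hq1]
      ring
    rw [hrhs, Real.mul_rpow (by positivity) (by positivity), Real.mul_rpow hc0.le hxj.le]
    have ecp : c ^ p = c * (s * (N - s)) := by
      rw [← hcp, Real.rpow_sub_one hc0.ne']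
      field_simp
    have exj : x j ^ p ≤ x j * q ^ ((p - 1) / 2) := by
      have h1 : x j ≤ ‖x‖ := (le_abs_self _).trans (PiLp.norm_apply_le x j)
      have h2 : q ^ ((p - 1) / 2) = ‖x‖ ^ (p - 1) := by
        rw [hq, ← Real.rpow_natCast, ← Real.rpow_mul (norm_nonneg _)]
        congr 1
        push_cast
        ring
      have h3 : x j ^ p = x j * x j ^ (p - 1) := by
        rw [Real.rpow_sub_one hxj.ne']
        field_simp
      rw [h2, h3]
      gcongr
    have eexp : q ^ (-s / 2 - 1) = q ^ ((p - 1) / 2) * (q ^ (-s / 2)) ^ p := by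
      rw [← Real.rpow_mul hq0.le, ← Real.rpow_add hq0]
      congr 1
      linarith
    rw [ecp, eexp]
    calc c * (s * (N - s)) * x j ^ p * (q ^ (-s / 2)) ^ p
        ≤ c * (s * (N - s)) * (x j * q ^ ((p - 1) / 2)) * (q ^ (-s / 2)) ^ p := by gcongr
      _ = _ := by ring


/-- The set of exponents `p > 1` for which `-Δu = u^p` has a positive supersolution at
infinity in the half-space cone `C₊` is exactly `((N+1)/(N-1), ∞)`; in particular the
critical exponent is `(N+1)/(N-1)` and is not attained. -/
theorem critical_exponent_halfspace (N : ℕ) (hN : 3 ≤ N) :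
    let S : Set ℝ := {p | 1 < p ∧ ∃ ρ : ℝ, 0 < ρ ∧ ∃ u : EuclideanSpace ℝ (Fin N) → ℝ,
        ContDiffOn ℝ 2 u {x | 0 < lastCoord x ∧ ρ < ‖x‖} ∧
        (∀ x : EuclideanSpace ℝ (Fin N), 0 < lastCoord x → ρ < ‖x‖ → 0 < u x) ∧
        (∀ x : EuclideanSpace ℝ (Fin N), 0 < lastCoord x → ρ < ‖x‖ → -lap u x ≥ u x ^ p)}
    S = {p : ℝ | ((N : ℝ) + 1) / ((N : ℝ) - 1) < p} ∧
      sInf S = ((N : ℝ) + 1) / ((N : ℝ) - 1) ∧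
      ((N : ℝ) + 1) / ((N : ℝ) - 1) ∉ S := by
  intro S
  have hN' : (3 : ℝ) ≤ N := by exact_mod_cast hN
  have hN1 : 0 < (N : ℝ) - 1 := by linarith
  set j : Fin N := ⟨N - 1, Nat.sub_lt (by omega) Nat.one_pos⟩ with hj
  have hlast : ∀ x : EuclideanSpace ℝ (Fin N), lastCoord x = x j := fun x =>
    dif_pos (show 0 < N by omega)
  have hone : 1 < ((N : ℝ) + 1) / ((N : ℝ) - 1) := by
    rw [lt_div_iff₀ hN1]
    linarith
  have hS : S = Set.Ioi (((N : ℝ) + 1) / ((N : ℝ) - 1)) := by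
    ext p
    simp only [S, hlast, Set.mem_ofPred_eq, Set.mem_Ioi]
    constructor
    · rintro ⟨hp, ρ, hρ, u, hu, hpos, hsuper⟩
      by_contra! hle
      obtain ⟨v, hv, hvs⟩ := exists_global_supersolution j hu hpos hsuper
      have hp1 : 0 < p - 1 := by linarith
      have hcrit : (N : ℝ) + 1 ≤ 2 * (1 + 1 / (p - 1)) := by
        rw [le_div_iff₀ hN1] at hle
        have : 2 * (1 + 1 / (p - 1)) = 2 * p / (p - 1) := by
          field_simp
          ring
        rw [this, le_div_iff₀ hp1]
        linarith
      exact no_global_supersolution (by omega) j hp hcrit (pow_pos hρ 2) hv hvs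
    · intro hp
      have hp1 : 1 < p := hone.trans hp
      have hs : (p + 1) / (p - 1) < N := by
        rw [div_lt_iff₀ hN1] at hp
        rw [div_lt_iff₀ (by linarith)]
        linarith
      obtain ⟨u, hu, hus⟩ := exists_supersolution j hp1 hs
      exact ⟨hp1, 1, one_pos, u, hu.mono fun x hx h0 => by simp [h0] at hx,
        fun x hx _ => (hus x hx).1, fun x hx _ => (hus x hx).2⟩
  refine ⟨hS, ?_, ?_⟩
  · rw [hS, csInf_Ioi]
  · rw [hS]
    exact Set.self_notMem_Ioi
end

section
/- Let N ≥ 3 and p ∈ (1, N/(N-2)); set α := -2/(p-1) and k := α(α+N-2)/(N-1), and let A_p(x) := k·I + (1-k)·(x/‖x‖)(x/‖x‖)ᵀ for x ≠ 0. Then: (a) A_p is symmetric and uniformly elliptic on ℝ^N ∖ {0}: with ν := max(k, 1/k) one has ν^{-1}·‖ξ‖² ≤ ⟨ξ, A_p(x)·ξ⟩ ≤ ν·‖ξ‖² for all x ≠ 0 and all ξ ∈ ℝ^N; and (b) defining S_p := {q : ℝ | q > 1 and there exist ρ > 0 and a function u : ℝ^N → ℝ which is C² on C₊ ∩ {‖x‖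 > ρ}, positive there, and satisfies -div(A_p∇u)(x) ≥ u(x)^q on that set}, one has S_p = {q : ℝ | q > p}; in particular sInf S_p = p and p ∉ S_p. (The paper's Theorem 1.4: for every p ∈ (1, N/(N-2)) there is an explicit uniformly elliptic matrix field for which the critical exponent of -div(a∇u) = u^q on a fixed cone-like domain equals exactly p; so, in contrast with exterior domains, the critical exponent depends on the coefficients of the equation.) -/
/-- The divergence-form operator `div(A∇u)(x) = ∑_i ∂_i(∑_j A_{ij} ∂_j u)(x)`. -/
noncomputable def divAgrad {N : ℕ}
    (A : EuclideanSpace ℝ (Fin N) → Matrix (Fin N) (Fin N) ℝ)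
    (u : EuclideanSpace ℝ (Fin N) → ℝ) (x : EuclideanSpace ℝ (Fin N)) : ℝ :=
  ∑ i, fderiv ℝ
    (fun y => ∑ j, A y i j * fderiv ℝ u y (EuclideanSpace.single j 1)) x
    (EuclideanSpace.single i 1)

/-- The matrix field `A(x) = k·I + (1-k)·(x/‖x‖)(x/‖x‖)ᵀ`. -/
noncomputable def Amat {N : ℕ} (k : ℝ) (x : EuclideanSpace ℝ (Fin N)) :
    Matrix (Fin N) (Fin N) ℝ :=
  Matrix.of fun i j => k * (if i = j then 1 else 0) + (1 - k) * (x i * x j) / ‖x‖ ^ 2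

section

open Filter Topology

/-- The second derivative of `u` at `x` in the directions `v` and `w`. -/
noncomputable def hess {N : ℕ} (u : EuclideanSpace ℝ (Fin N) → ℝ)
    (x v w : EuclideanSpace ℝ (Fin N)) : ℝ :=
  fderiv ℝ (fderiv ℝ u) x v w

theorem sum_coord_single {N : ℕ} (x : EuclideanSpace ℝ (Fin N)) :
    ∑ i, x i • EuclideanSpace.single i (1 : ℝ) = x := by
  have := (EuclideanSpace.basisFun (Fin N) ℝ).sum_repr x
  simpa using this

theorem sum_coord_sq {N : ℕ} (x : EuclideanSpace ℝ (Fin N)) :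
    ∑ i, x i * x i = ‖x‖ ^ 2 := by
  rw [EuclideanSpace.real_norm_sq_eq]
  simp [sq]

theorem sum_coord_apply {N : ℕ} (T : EuclideanSpace ℝ (Fin N) →L[ℝ] ℝ)
    (x : EuclideanSpace ℝ (Fin N)) :
    ∑ i, x i * T (EuclideanSpace.single i 1) = T x := by
  conv_rhs => rw [← sum_coord_single x]
  simp [map_sum]

theorem ContDiffAt.hasFDerivAt_fderiv_of_two {N : ℕ} {u : EuclideanSpace ℝ (Fin N) → ℝ}
    {x : EuclideanSpace ℝ (Fin N)} (hu : ContDiffAt ℝ 2 u x) :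
    HasFDerivAt (fderiv ℝ u) (fderiv ℝ (fderiv ℝ u) x) x :=
  ((hu.fderiv_right (m := 1) (by norm_num)).differentiableAt (by norm_num)).hasFDerivAt

/-- Nondivergence form of `div(A∇u)` for `A = k·I + (1-k)·(x/‖x‖)(x/‖x‖)ᵀ`. -/
theorem divAgrad_Amat {N : ℕ} (k : ℝ) {u : EuclideanSpace ℝ (Fin N) → ℝ}
    {x : EuclideanSpace ℝ (Fin N)} (hx : x ≠ 0) (hu : ContDiffAt ℝ 2 u x) :
    divAgrad (Amat k) u x = k * ∑ i, hess u x (EuclideanSpace.single i 1)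
        (EuclideanSpace.single i 1) +
      (1 - k) / ‖x‖ ^ 2 * (hess u x x x + ((N : ℝ) - 1) * fderiv ℝ u x x) := by
  have hs : ‖x‖ ^ 2 ≠ 0 := by positivity
  have key : ∀ i : Fin N, fderiv ℝ
      (fun y => ∑ j, Amat k y i j * fderiv ℝ u y (EuclideanSpace.single j 1)) x
      (EuclideanSpace.single i 1) =
      k * hess u x (EuclideanSpace.single i 1) (EuclideanSpace.single i 1) +
      (1 - k) * ((1 / ‖x‖ ^ 2 - 2 * (x i * x i) / (‖x‖ ^ 2) ^ 2) * fderiv ℝ u x x +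
        (1 / ‖x‖ ^ 2) * (x i * hess u x (EuclideanSpace.single i 1) x +
        x i * fderiv ℝ u x (EuclideanSpace.single i 1))) := by
    intro i
    have hfun : (fun y => ∑ j, Amat k y i j * fderiv ℝ u y (EuclideanSpace.single j 1)) =
        fun y => k * fderiv ℝ u y (EuclideanSpace.single i 1) +
          (1 - k) * ((y i * (‖y‖ ^ 2)⁻¹) * fderiv ℝ u y y) := by
      funext y
      have h1 : ∀ j, Amat k y i j * fderiv ℝ u y (EuclideanSpace.single j 1) =
          (if i = j then k * fderiv ℝ u y (EuclideanSpace.single j 1) else 0) +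
          ((1 - k) * (y i * (‖y‖ ^ 2)⁻¹)) *
            (y j * fderiv ℝ u y (EuclideanSpace.single j 1)) := by
        intro j
        simp only [Amat, Matrix.of_apply]
        split_ifs <;> ring
      simp_rw [h1]
      rw [Finset.sum_add_distrib, ← Finset.mul_sum, sum_coord_apply]
      simp
      ring
    rw [hfun]
    have hD := hu.hasFDerivAt_fderiv_of_two
    have h1 : HasFDerivAt (fun y => fderiv ℝ u y (EuclideanSpace.single i 1)) _ x :=
      hD.clm_apply (hasFDerivAt_const (EuclideanSpace.single i (1 : ℝ)) x)
    have h2 : HasFDerivAt (fun y => fderiv ℝ u y y) _ x := hD.clm_apply (hasFDerivAt_id x)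
    have h3 : HasFDerivAt (fun y : EuclideanSpace ℝ (Fin N) => y i) _ x :=
      (EuclideanSpace.proj (𝕜 := ℝ) i : EuclideanSpace ℝ (Fin N) →L[ℝ] ℝ).hasFDerivAt
    have h4 : HasFDerivAt (fun y : EuclideanSpace ℝ (Fin N) => ‖y‖ ^ 2) _ x :=
      (hasStrictFDerivAt_norm_sq x).hasFDerivAt
    have h5 : HasFDerivAt (fun y : EuclideanSpace ℝ (Fin N) => (‖y‖ ^ 2)⁻¹) _ x :=
      (hasDerivAt_inv hs).comp_hasFDerivAt x h4
    have h6 := (h1.const_mul k).fun_add (((h3.fun_mul h5).fun_mul h2).const_mul (1 - k))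
    rw [HasFDerivAt.fderiv h6]
    simp [hess, innerSL_apply_apply, EuclideanSpace.inner_single_right]
    field_simp
    ring
  unfold divAgrad
  simp_rw [key]
  rw [Finset.sum_add_distrib, ← Finset.mul_sum, ← Finset.mul_sum, Finset.sum_add_distrib,
    ← Finset.sum_mul, ← Finset.mul_sum, Finset.sum_sub_distrib, Finset.sum_add_distrib,
    sum_coord_apply]
  have h7 : ∑ i, x i * hess u x (EuclideanSpace.single i 1) x = hess u x x x := by
    have := sum_coord_apply ((fderiv ℝ (fderiv ℝ u) x).flip x) x
    simpa [hess] using this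
  have h8 : ∑ i, 2 * (x i * x i) / (‖x‖ ^ 2) ^ 2 = 2 / ‖x‖ ^ 2 := by
    rw [← Finset.sum_div, ← Finset.mul_sum, sum_coord_sq]
    field_simp
  rw [h7, h8]
  simp
  field_simp
  ring

theorem divAgrad_Amat_lin {N : ℕ} (k : ℝ) {u v : EuclideanSpace ℝ (Fin N) → ℝ}
    {x : EuclideanSpace ℝ (Fin N)} (hx : x ≠ 0) (hu : ContDiffAt ℝ 2 u x)
    (hv : ContDiffAt ℝ 2 v x) (a b : ℝ) :
    divAgrad (Amat k) (fun y => a * u y + b * v y) x =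
      a * divAgrad (Amat k) u x + b * divAgrad (Amat k) v x := by
  have hev : fderiv ℝ (fun y => a * u y + b * v y) =ᶠ[𝓝 x]
      fun y => a • fderiv ℝ u y + b • fderiv ℝ v y := by
    filter_upwards [hu.eventually (by simp), hv.eventually (by simp)] with y h1 h2
    exact ((h1.differentiableAt (by norm_num)).hasFDerivAt.const_mul a |>.add
      ((h2.differentiableAt (by norm_num)).hasFDerivAt.const_mul b)).fderiv
  have h2 : ∀ p w, hess (fun y => a * u y + b * v y) x p w =
      a * hess u x p w + b * hess v x p w := by
    intro p w
    unfold hess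
    rw [hev.fderiv_eq, ((hu.hasFDerivAt_fderiv_of_two.fun_const_smul a).fun_add
      (hv.hasFDerivAt_fderiv_of_two.fun_const_smul b)).fderiv]
    simp
  rw [divAgrad_Amat k hx hu, divAgrad_Amat k hx hv,
    divAgrad_Amat k hx ((contDiffAt_const.mul hu).add (contDiffAt_const.mul hv)),
    hev.eq_of_nhds]
  simp only [h2, Finset.sum_add_distrib, ← Finset.mul_sum, add_apply,
    smul_apply, smul_eq_mul]
  ring

theorem IsLocalMin.hess_nonneg {N : ℕ} {u : EuclideanSpace ℝ (Fin N) → ℝ}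
    {x : EuclideanSpace ℝ (Fin N)} (hu : ContDiffAt ℝ 2 u x) (h : IsLocalMin u x)
    (w : EuclideanSpace ℝ (Fin N)) : 0 ≤ hess u x w w := by
  by_contra! hneg
  have hl : ∀ τ : ℝ, HasDerivAt (fun τ : ℝ => x + τ • w) w τ := fun τ => by
    simpa using ((hasDerivAt_id τ).smul_const w).const_add x
  have hc : Tendsto (fun τ : ℝ => x + τ • w) (𝓝 0) (𝓝 x) := by
    have := (hl 0).continuousAt.tendsto
    simpa using this
  have hd : deriv (fun τ : ℝ => u (x + τ • w)) =ᶠ[𝓝 0]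
      fun τ => fderiv ℝ u (x + τ • w) w := by
    filter_upwards [hc.eventually (hu.eventually (by simp))] with τ hτ
    exact ((hτ.differentiableAt (by norm_num)).hasFDerivAt.comp_hasDerivAt τ (hl τ)).deriv
  have hx0 : x + (0 : ℝ) • w = x := by simp
  have hdd : deriv (deriv (fun τ : ℝ => u (x + τ • w))) 0 = hess u x w w := by
    rw [hd.deriv_eq]
    have h1 : HasFDerivAt (fun y => fderiv ℝ u y w)
        ((fderiv ℝ (fderiv ℝ u) x).flip w) (x + (0 : ℝ) • w) := by
      rw [hx0]
      simpa using hu.hasFDerivAt_fderiv_of_two.clm_apply (hasFDerivAt_const w x)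
    have := (h1.comp_hasDerivAt (0 : ℝ) (hl 0)).deriv
    simpa [hess, Function.comp_def] using this
  have hmin : ∀ᶠ τ in 𝓝 (0 : ℝ), u x ≤ u (x + τ • w) := hc.eventually h
  have hmax := isLocalMax_of_deriv_deriv_neg (f := fun τ : ℝ => u (x + τ • w)) (x₀ := 0)
    (by rw [hdd]; exact hneg)
    (by rw [hd.eq_of_nhds, hx0, h.fderiv_eq_zero]; simp)
    (ContinuousAt.comp (g := u) (by rw [hx0]; exact hu.continuousAt) (hl 0).continuousAt)
  have hconst : (fun τ : ℝ => u (x + τ • w)) =ᶠ[𝓝 0] fun _ => u x := by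
    filter_upwards [hmin, hmax] with τ h1 h2
    simp only [hx0] at h2
    exact le_antisymm h2 h1
  have : deriv (deriv (fun τ : ℝ => u (x + τ • w))) 0 = 0 := by
    rw [hconst.deriv.deriv_eq]
    simp
  linarith

theorem IsLocalMin.divAgrad_Amat_nonneg {N : ℕ} {k : ℝ} (hk : 0 ≤ k)
    {u : EuclideanSpace ℝ (Fin N) → ℝ} {x : EuclideanSpace ℝ (Fin N)} (hx : x ≠ 0)
    (hu : ContDiffAt ℝ 2 u x) (h : IsLocalMin u x) : 0 ≤ divAgrad (Amat k) u x := by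
  have hs : ‖x‖ ^ 2 ≠ 0 := by positivity
  rw [divAgrad_Amat k hx hu, h.fderiv_eq_zero]
  set H := fderiv ℝ (fderiv ℝ u) x
  have hsq : √k * √k = k := Real.mul_self_sqrt hk
  have h1 : ∀ i : Fin N, 0 ≤
      hess u x (√k • EuclideanSpace.single i 1 + ((1 - √k) * x i / ‖x‖ ^ 2) • x)
      (√k • EuclideanSpace.single i 1 + ((1 - √k) * x i / ‖x‖ ^ 2) • x) :=
    fun i => h.hess_nonneg hu _
  have h2 := Finset.sum_nonneg fun i (_ : i ∈ Finset.univ) => h1 i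
  have h3 : ∀ i : Fin N,
      hess u x (√k • EuclideanSpace.single i 1 + ((1 - √k) * x i / ‖x‖ ^ 2) • x)
      (√k • EuclideanSpace.single i 1 + ((1 - √k) * x i / ‖x‖ ^ 2) • x) =
      k * hess u x (EuclideanSpace.single i 1) (EuclideanSpace.single i 1) +
      √k * (1 - √k) / ‖x‖ ^ 2 * (x i * hess u x x (EuclideanSpace.single i 1)) +
      √k * (1 - √k) / ‖x‖ ^ 2 * (x i * hess u x (EuclideanSpace.single i 1) x) +
      (1 - √k) ^ 2 / (‖x‖ ^ 2) ^ 2 * hess u x x x * (x i * x i) := by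
    intro i
    simp only [hess, map_add, map_smul, add_apply, smul_apply, smul_eq_mul]
    linear_combination (fderiv ℝ (fderiv ℝ u) x) (EuclideanSpace.single i 1)
      (EuclideanSpace.single i 1) * hsq
  simp_rw [h3] at h2
  have h7 : ∑ i, x i * hess u x (EuclideanSpace.single i 1) x = hess u x x x := by
    have := sum_coord_apply ((fderiv ℝ (fderiv ℝ u) x).flip x) x
    simpa [hess] using this
  have h8 : ∑ i, x i * hess u x x (EuclideanSpace.single i 1) = hess u x x x :=
    sum_coord_apply (fderiv ℝ (fderiv ℝ u) x x) x
  simp only [Finset.sum_add_distrib, ← Finset.mul_sum, h7, h8, sum_coord_sq] at h2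
  refine h2.trans_eq ?_
  simp only [zero_apply, mul_zero, add_zero]
  rw [add_assoc, add_assoc]
  congr 1
  field_simp
  linear_combination (-hess u x x x) * hsq

/-- `f₀(‖x‖²) + f₁(‖x‖²) x_e + f₂(‖x‖²) x_e²`. -/
noncomputable def radialQuad {N : ℕ} (e : Fin N) (f₀ f₁ f₂ : ℝ → ℝ)
    (x : EuclideanSpace ℝ (Fin N)) : ℝ :=
  f₀ (‖x‖ ^ 2) + f₁ (‖x‖ ^ 2) * x e + f₂ (‖x‖ ^ 2) * x e ^ 2

theorem contDiffAt_radialQuad {N : ℕ} (e : Fin N) {f₀ f₁ f₂ : ℝ → ℝ}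
    {x : EuclideanSpace ℝ (Fin N)} (h₀ : ContDiffAt ℝ 2 f₀ (‖x‖ ^ 2))
    (h₁ : ContDiffAt ℝ 2 f₁ (‖x‖ ^ 2)) (h₂ : ContDiffAt ℝ 2 f₂ (‖x‖ ^ 2)) :
    ContDiffAt ℝ 2 (radialQuad e f₀ f₁ f₂) x := by
  have hn : ContDiffAt ℝ 2 (fun y : EuclideanSpace ℝ (Fin N) => ‖y‖ ^ 2) x :=
    (contDiff_norm_sq ℝ).contDiffAt
  have hc : ContDiffAt ℝ 2 (fun y : EuclideanSpace ℝ (Fin N) => y e) x :=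
    (EuclideanSpace.proj (𝕜 := ℝ) e : EuclideanSpace ℝ (Fin N) →L[ℝ] ℝ).contDiff.contDiffAt
  exact ((h₀.comp x hn).add ((h₁.comp x hn).mul hc)).add ((h₂.comp x hn).mul (hc.pow 2))

theorem divAgrad_radialQuad {N : ℕ} (k : ℝ) (e : Fin N)
    {f₀ f₁ f₂ f₀' f₁' f₂' f₀'' f₁'' f₂'' : ℝ → ℝ}
    {x : EuclideanSpace ℝ (Fin N)} (hx : x ≠ 0)
    (hf : ContDiffAt ℝ 2 (radialQuad e f₀ f₁ f₂) x)
    (h₀ : ∀ s > 0, HasDerivAt f₀ (f₀' s) s) (h₀' : ∀ s > 0, HasDerivAt f₀' (f₀'' s) s)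
    (h₁ : ∀ s > 0, HasDerivAt f₁ (f₁' s) s) (h₁' : ∀ s > 0, HasDerivAt f₁' (f₁'' s) s)
    (h₂ : ∀ s > 0, HasDerivAt f₂ (f₂' s) s) (h₂' : ∀ s > 0, HasDerivAt f₂' (f₂'' s) s)
    {s z : ℝ} (hs : s = ‖x‖ ^ 2) (hz : z = x e) :
    divAgrad (Amat k) (radialQuad e f₀ f₁ f₂) x =
      (4 * s * f₀'' s + 2 * N * f₀' s) +
      z * (4 * s * f₁'' s + 4 * f₁' s + 2 * N * f₁' s + (1 - k) * (N - 1) * f₁ s / s) +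
      (z ^ 2 * (4 * s * f₂'' s + 8 * f₂' s + 2 * N * f₂' s + (1 - k) * (2 * N) * f₂ s / s) +
        2 * k * f₂ s) := by
  have hspos : ∀ y : EuclideanSpace ℝ (Fin N), y ≠ 0 → 0 < ‖y‖ ^ 2 := fun y hy => by positivity
  have hn : ∀ y : EuclideanSpace ℝ (Fin N), HasFDerivAt
      (fun y : EuclideanSpace ℝ (Fin N) => ‖y‖ ^ 2) (2 • innerSL ℝ y) y :=
    fun y => (hasStrictFDerivAt_norm_sq y).hasFDerivAt
  have hc : ∀ y : EuclideanSpace ℝ (Fin N), HasFDerivAt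
      (fun y : EuclideanSpace ℝ (Fin N) => y e)
      (EuclideanSpace.proj (𝕜 := ℝ) e : EuclideanSpace ℝ (Fin N) →L[ℝ] ℝ) y :=
    fun y => (EuclideanSpace.proj (𝕜 := ℝ) e :
      EuclideanSpace ℝ (Fin N) →L[ℝ] ℝ).hasFDerivAt
  have hcomp : ∀ {f f' : ℝ → ℝ}, (∀ s > 0, HasDerivAt f (f' s) s) →
      ∀ y : EuclideanSpace ℝ (Fin N), y ≠ 0 → HasFDerivAt
      (fun y : EuclideanSpace ℝ (Fin N) => f (‖y‖ ^ 2)) (f' (‖y‖ ^ 2) • 2 • innerSL ℝ y) y :=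
    fun hf y hy => (hf _ (hspos y hy)).comp_hasFDerivAt y (hn y)
  have hfirst : ∀ y : EuclideanSpace ℝ (Fin N), y ≠ 0 → ∀ w,
      fderiv ℝ (radialQuad e f₀ f₁ f₂) y w =
      (f₀' (‖y‖ ^ 2) + f₁' (‖y‖ ^ 2) * y e + f₂' (‖y‖ ^ 2) * (y e * y e)) *
        (2 * inner ℝ w y) + (f₁ (‖y‖ ^ 2) + 2 * (f₂ (‖y‖ ^ 2) * y e)) * w e := by
    intro y hy w
    have := (((hcomp h₀ y hy).fun_add ((hcomp h₁ y hy).fun_mul (hc y))).fun_add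
      ((hcomp h₂ y hy).fun_mul ((hc y).fun_mul (hc y))))
    have hdef : radialQuad e f₀ f₁ f₂ = fun y : EuclideanSpace ℝ (Fin N) =>
        f₀ (‖y‖ ^ 2) + f₁ (‖y‖ ^ 2) * y e + f₂ (‖y‖ ^ 2) * (y e * y e) := by
      funext y
      simp only [radialQuad, sq (y e)]
    rw [hdef, this.fderiv]
    simp [innerSL_apply_apply, real_inner_comm w y]
    ring
  have hsecond : ∀ v w, hess (radialQuad e f₀ f₁ f₂) x v w =
      2 * ((f₀'' (‖x‖ ^ 2) + f₁'' (‖x‖ ^ 2) * x e + f₂'' (‖x‖ ^ 2) * (x e * x e)) *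
        (2 * inner ℝ x v) + (f₁' (‖x‖ ^ 2) + 2 * f₂' (‖x‖ ^ 2) * x e) * v e) * inner ℝ w x +
      2 * (f₀' (‖x‖ ^ 2) + f₁' (‖x‖ ^ 2) * x e + f₂' (‖x‖ ^ 2) * (x e * x e)) * inner ℝ w v +
      ((f₁' (‖x‖ ^ 2) + 2 * f₂' (‖x‖ ^ 2) * x e) * (2 * inner ℝ x v) +
        2 * f₂ (‖x‖ ^ 2) * v e) * w e := by
    intro v w
    have h1 : hess (radialQuad e f₀ f₁ f₂) x v w =
        fderiv ℝ (fun y => fderiv ℝ (radialQuad e f₀ f₁ f₂) y w) x v := by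
      rw [(hf.hasFDerivAt_fderiv_of_two.clm_apply (hasFDerivAt_const w x)).fderiv]
      simp [hess]
    have h2 : (fun y => fderiv ℝ (radialQuad e f₀ f₁ f₂) y w) =ᶠ[𝓝 x] fun y =>
        (f₀' (‖y‖ ^ 2) + f₁' (‖y‖ ^ 2) * y e + f₂' (‖y‖ ^ 2) * (y e * y e)) *
        (2 * inner ℝ w y) + (f₁ (‖y‖ ^ 2) + 2 * (f₂ (‖y‖ ^ 2) * y e)) * w e := by
      filter_upwards [isOpen_ne.mem_nhds hx] with y hy
      exact hfirst y hy w
    have h3 : HasFDerivAt (fun y : EuclideanSpace ℝ (Fin N) => inner ℝ w y) (innerSL ℝ w) x :=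
      (innerSL ℝ w).hasFDerivAt
    have h4 := (((((hcomp h₀' x hx).fun_add ((hcomp h₁' x hx).fun_mul (hc x))).fun_add
      ((hcomp h₂' x hx).fun_mul ((hc x).fun_mul (hc x)))).fun_mul (h3.const_mul 2)).fun_add
      (((hcomp h₁ x hx).fun_add (((hcomp h₂ x hx).fun_mul (hc x)).const_mul 2)).mul_const (w e)))
    rw [h1, h2.fderiv_eq, h4.fderiv]
    simp [innerSL_apply_apply]
    ring
  have hs0 : s ≠ 0 := hs ▸ (hspos x hx).ne'
  rw [divAgrad_Amat k hx hf]
  have hee : ∀ i : Fin N, hess (radialQuad e f₀ f₁ f₂) x (EuclideanSpace.single i 1)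
      (EuclideanSpace.single i 1) =
      4 * (f₀'' s + f₁'' s * z + f₂'' s * (z * z)) * (x i * x i) +
      2 * (f₀' s + f₁' s * z + f₂' s * (z * z)) +
      (if i = e then 4 * (f₁' s + 2 * f₂' s * z) * x i + 2 * f₂ s else 0) := by
    intro i
    rw [hsecond, ← hs, ← hz]
    have : (EuclideanSpace.single i (1 : ℝ) : EuclideanSpace ℝ (Fin N)) e =
      if i = e then 1 else 0 := by simp [eq_comm]
    rw [this]
    split_ifs <;>
    · simp [EuclideanSpace.inner_single_right, EuclideanSpace.inner_single_left]
      ring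
  have htr : ∑ i, hess (radialQuad e f₀ f₁ f₂) x (EuclideanSpace.single i 1)
      (EuclideanSpace.single i 1) =
      4 * (f₀'' s + f₁'' s * z + f₂'' s * (z * z)) * s +
      N * (2 * (f₀' s + f₁' s * z + f₂' s * (z * z))) +
      (4 * (f₁' s + 2 * f₂' s * z) * z + 2 * f₂ s) := by
    simp_rw [hee]
    rw [Finset.sum_add_distrib, Finset.sum_add_distrib, ← Finset.mul_sum, sum_coord_sq, ← hs]
    simp [hz]
  rw [htr, hsecond, hfirst x hx, real_inner_self_eq_norm_sq, ← hs, ← hz]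
  field_simp
  ring

theorem isOpen_cone_inter_exterior {N : ℕ} (e : Fin N) (ρ : ℝ) :
    IsOpen {x : EuclideanSpace ℝ (Fin N) | 0 < x e ∧ ρ < ‖x‖} :=
  (isOpen_lt continuous_const (EuclideanSpace.proj (𝕜 := ℝ) e).continuous).inter
    (isOpen_lt continuous_const continuous_norm)

/-- A function which is negative on `{x_e = 0}` can be scaled below a positive function
on a half sphere. -/
theorem exists_scale_le_on_sphere {N : ℕ} (e : Fin N) {ρ r₀ c : ℝ} (hρ : 0 < ρ) (hr : ρ < r₀)
    (hc : 0 < c) {u φ : EuclideanSpace ℝ (Fin N) → ℝ}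
    (hu : ContinuousOn u {x | 0 < x e ∧ ρ < ‖x‖})
    (hpos : ∀ x : EuclideanSpace ℝ (Fin N), 0 < x e → ρ < ‖x‖ → 0 < u x)
    (hφ : ContinuousOn φ {x | x ≠ 0})
    (hneg : ∀ x : EuclideanSpace ℝ (Fin N), x e = 0 → x ≠ 0 → φ x < 0) :
    ∃ s > 0, s ≤ c ∧
      ∀ x : EuclideanSpace ℝ (Fin N), 0 < x e → ‖x‖ = r₀ → s * φ x ≤ u x := by
  have hce : Continuous fun x : EuclideanSpace ℝ (Fin N) => x e :=
    (EuclideanSpace.proj (𝕜 := ℝ) e).continuous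
  have hr₀ : 0 < r₀ := hρ.trans hr
  set S : Set (EuclideanSpace ℝ (Fin N)) := Metric.sphere 0 r₀ ∩ {x | 0 ≤ x e}
  have hScpt : IsCompact S := (isCompact_sphere 0 r₀).inter_right (isClosed_le continuous_const hce)
  have hSne : ∀ x ∈ S, x ≠ 0 := by
    rintro x ⟨hx, -⟩ rfl
    simp at hx
    linarith
  have hφS : ContinuousOn φ S := hφ.mono hSne
  set K := S ∩ φ ⁻¹' Set.Ici 0
  have hKcpt : IsCompact K := hScpt.of_isClosed_subset
    (hφS.preimage_isClosed_of_isClosed hScpt.isClosed isClosed_Ici) Set.inter_subset_left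
  have hKpos : ∀ x ∈ K, 0 < x e ∧ ρ < ‖x‖ := by
    rintro x ⟨hx, hx'⟩
    refine ⟨lt_of_le_of_ne hx.2 fun h => ?_, ?_⟩
    · exact absurd (hneg x h.symm (hSne x hx)) (not_lt.2 hx')
    · have : ‖x‖ = r₀ := by simpa using hx.1
      rwa [this]
  rcases K.eq_empty_or_nonempty with hemp | hne
  · refine ⟨c, hc, le_rfl, fun x hx hxr => ?_⟩
    have hxS : x ∈ S := ⟨by simpa using hxr, hx.le⟩
    have : φ x < 0 := by
      by_contra! h
      have : x ∈ K := ⟨hxS, h⟩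
      simp [hemp] at this
    have h2 := hpos x hx (hxr ▸ hr)
    nlinarith
  · obtain ⟨a, ha, hamin⟩ := hKcpt.exists_isMinOn hne (hu.mono hKpos)
    obtain ⟨b, hb, hbmax⟩ := hKcpt.exists_isMaxOn hne (hφS.mono Set.inter_subset_left)
    have hua := hpos a (hKpos a ha).1 (hKpos a ha).2
    have hφb : 0 ≤ φ b := hb.2
    refine ⟨min c (u a / (φ b + 1)), by positivity, min_le_left _ _, fun x hx hxr => ?_⟩
    have hux := hpos x hx (hxr ▸ hr)
    have hs : 0 < min c (u a / (φ b + 1)) := by positivity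
    rcases lt_or_ge (φ x) 0 with h | h
    · nlinarith
    · have hxK : x ∈ K := ⟨⟨by simpa using hxr, hx.le⟩, h⟩
      calc min c (u a / (φ b + 1)) * φ x ≤ u a / (φ b + 1) * (φ b + 1) := by
            gcongr
            · exact min_le_right _ _
            · exact (hbmax hxK).trans (by linarith)
        _ = u a := by field_simp
        _ ≤ u x := hamin hxK

theorem supersolution_lower_bound {N : ℕ} {k : ℝ} (hk : 0 ≤ k) (e : Fin N) {ρ r₀ c : ℝ}
    (hρ : 0 < ρ) (hr : ρ < r₀) (hc : 0 < c) {u φ g : EuclideanSpace ℝ (Fin N) → ℝ}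
    (hu : ContDiffOn ℝ 2 u {x | 0 < x e ∧ ρ < ‖x‖})
    (hpos : ∀ x : EuclideanSpace ℝ (Fin N), 0 < x e → ρ < ‖x‖ → 0 < u x)
    (hφ : ∀ x : EuclideanSpace ℝ (Fin N), x ≠ 0 → ContDiffAt ℝ 2 φ x)
    (hlim : Tendsto φ (cocompact _) (𝓝 0))
    (hneg : ∀ x : EuclideanSpace ℝ (Fin N), x e = 0 → x ≠ 0 → φ x < 0)
    (hg : ∀ x, 0 ≤ g x)
    (hug : ∀ x : EuclideanSpace ℝ (Fin N), 0 < x e → r₀ < ‖x‖ →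
      c * g x ≤ -divAgrad (Amat k) u x)
    (hφg : ∀ x : EuclideanSpace ℝ (Fin N), 0 < x e → r₀ < ‖x‖ →
      -divAgrad (Amat k) φ x < g x) :
    ∃ s > 0, ∀ x : EuclideanSpace ℝ (Fin N), 0 < x e → r₀ ≤ ‖x‖ → s * φ x ≤ u x := by
  have hφc : ContinuousOn φ {x | x ≠ 0} := fun x hx => (hφ x hx).continuousAt.continuousWithinAt
  obtain ⟨s, hs, hsc, hsph⟩ :=
    exists_scale_le_on_sphere e hρ hr hc hu.continuousOn hpos hφc hneg
  refine ⟨s, hs, fun y hy hyr => ?_⟩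
  by_contra! hlt
  have hce : Continuous fun x : EuclideanSpace ℝ (Fin N) => x e :=
    (EuclideanSpace.proj (𝕜 := ℝ) e).continuous
  set d := s * φ y - u y with hd
  have hd0 : 0 < d := by linarith
  set C : Set (EuclideanSpace ℝ (Fin N)) := {x | r₀ ≤ ‖x‖} ∩ {x | 0 ≤ x e}
  have hCcl : IsClosed C :=
    (isClosed_le continuous_const continuous_norm).inter (isClosed_le continuous_const hce)
  have hCne : ∀ x ∈ C, x ≠ 0 := by
    rintro x ⟨hx, -⟩ rfl
    simp at hx
    linarith
  set K := C ∩ (fun x => s * φ x) ⁻¹' Set.Ici d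
  have hsφ : ContinuousOn (fun x => s * φ x) {x | x ≠ 0} := continuousOn_const.mul hφc
  have hKcl : IsClosed K := (hsφ.mono hCne).preimage_isClosed_of_isClosed hCcl isClosed_Ici
  have hlim' : ∀ᶠ x in cocompact _, s * φ x < d := by
    have := hlim.const_mul s
    rw [mul_zero] at this
    exact this.eventually (gt_mem_nhds hd0)
  obtain ⟨T, hT, hTs⟩ := mem_cocompact.1 hlim'
  have hKcpt : IsCompact K := hT.of_isClosed_subset hKcl fun x hx => by
    by_contra hxT
    exact not_lt.2 (show d ≤ s * φ x from hx.2) (hTs hxT)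
  have hKpos : ∀ x ∈ K, 0 < x e ∧ ρ < ‖x‖ := by
    rintro x ⟨hx, hx'⟩
    refine ⟨lt_of_le_of_ne hx.2 fun h => ?_, hr.trans_le hx.1⟩
    have h1 := hneg x h.symm (hCne x hx)
    have h2 : d ≤ s * φ x := hx'
    nlinarith
  have hyK : y ∈ K := ⟨⟨hyr, hy.le⟩, by
    have := hpos y hy (hr.trans_le hyr)
    simp only [Set.mem_preimage, Set.mem_Ici]
    linarith⟩
  obtain ⟨x, hxK, hxmin⟩ := hKcpt.exists_isMinOn ⟨y, hyK⟩ (f := fun x => 1 * u x + (-s) * φ x)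
    ((continuousOn_const.mul (hu.continuousOn.mono hKpos)).add
      (continuousOn_const.mul (hφc.mono fun x hx => hCne x hx.1)))
  obtain ⟨hxe, hxρ⟩ := hKpos x hxK
  have hx0 : x ≠ 0 := hCne x hxK.1
  have hux := hpos x hxe hxρ
  have hle : 1 * u x + (-s) * φ x ≤ 1 * u y + (-s) * φ y := hxmin hyK
  have hxr : r₀ < ‖x‖ := by
    refine lt_of_le_of_ne hxK.1.1 fun h => ?_
    have := hsph x hxe h.symm
    linarith
  have hxd : d < s * φ x := by linarith
  have huc : ContDiffAt ℝ 2 u x :=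
    hu.contDiffAt ((isOpen_cone_inter_exterior e ρ).mem_nhds ⟨hxe, hxρ⟩)
  have hloc : IsLocalMin (fun x => 1 * u x + (-s) * φ x) x := by
    have h1 : ∀ᶠ z in 𝓝 x, d < s * φ z :=
      (((hφ x hx0).continuousAt).const_mul s).eventually (lt_mem_nhds hxd)
    filter_upwards [h1, (isOpen_cone_inter_exterior e r₀).mem_nhds ⟨hxe, hxr⟩] with z hz hz'
    exact hxmin ⟨⟨hz'.2.le, hz'.1.le⟩, hz.le⟩
  have hnn := hloc.divAgrad_Amat_nonneg hk hx0
    ((contDiffAt_const.mul huc).add (contDiffAt_const.mul (hφ x hx0)))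
  rw [divAgrad_Amat_lin k hx0 huc (hφ x hx0)] at hnn
  have h1 := hug x hxe hxr
  have h2 := hφg x hxe hxr
  have h3 := mul_le_mul_of_nonneg_right hsc (hg x)
  have h4 := mul_lt_mul_of_pos_left h2 hs
  linarith

/-- A positive function with `-div(A∇u) ≥ V u` excludes a strict subsolution of the same linear
equation vanishing on the boundary of a compact set. -/
theorem not_exists_strict_subsolution {N : ℕ} {k : ℝ} (hk : 0 ≤ k)
    {K : Set (EuclideanSpace ℝ (Fin N))} (hK : IsCompact K) (hK0 : ∀ x ∈ K, x ≠ 0)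
    {u φ V : EuclideanSpace ℝ (Fin N) → ℝ}
    (hu : ∀ x ∈ K, ContDiffAt ℝ 2 u x) (hφ : ∀ x ∈ K, ContDiffAt ℝ 2 φ x)
    (hpos : ∀ x ∈ K, 0 < u x) (hbdry : ∀ x ∈ K, 0 < φ x → K ∈ 𝓝 x)
    {y : EuclideanSpace ℝ (Fin N)} (hy : y ∈ K) (hφy : 0 < φ y)
    (huV : ∀ x ∈ K, V x * u x ≤ -divAgrad (Amat k) u x)
    (hφV : ∀ x ∈ K, 0 < φ x → -divAgrad (Amat k) φ x < V x * φ x) : False := by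
  obtain ⟨x, hx, hmax⟩ := hK.exists_isMaxOn ⟨y, hy⟩ (f := fun x => φ x / u x)
    (fun x hx => ((hφ x hx).continuousAt.div (hu x hx).continuousAt
      (hpos x hx).ne').continuousWithinAt)
  have hux := hpos x hx
  have hτ : 0 < φ x / u x := (div_pos hφy (hpos y hy)).trans_le (hmax hy)
  set τ := φ x / u x with hτd
  have hφx : φ x = τ * u x := by rw [hτd]; field_simp
  have hφx0 : 0 < φ x := hφx ▸ mul_pos hτ hux
  have hloc : IsLocalMin (fun x => τ * u x + (-1) * φ x) x := by
    filter_upwards [hbdry x hx hφx0] with z hz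
    have h1 : φ z / u z ≤ τ := hmax hz
    rw [div_le_iff₀ (hpos z hz)] at h1
    rw [hφx]
    linarith
  have hnn := hloc.divAgrad_Amat_nonneg hk (hK0 x hx)
    ((contDiffAt_const.mul (hu x hx)).add (contDiffAt_const.mul (hφ x hx)))
  rw [divAgrad_Amat_lin k (hK0 x hx) (hu x hx) (hφ x hx)] at hnn
  have h1 := mul_le_mul_of_nonneg_left (huV x hx) hτ.le
  have h2 := hφV x hx hφx0
  rw [hφx] at h2
  linarith

theorem hasDerivAt_mul_rpow (a b : ℝ) {s : ℝ} (hs : 0 < s) :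
    HasDerivAt (fun s : ℝ => a * s ^ b) (a * b * s ^ b / s) s := by
  have := (Real.hasDerivAt_rpow_const (x := s) (p := b) (Or.inl hs.ne')).const_mul a
  rw [Real.rpow_sub_one hs.ne'] at this
  exact this.congr_deriv (by ring)

theorem hasDerivAt_mul_rpow_div (a b : ℝ) {s : ℝ} (hs : 0 < s) :
    HasDerivAt (fun s : ℝ => a * b * s ^ b / s) (a * b * (b - 1) * s ^ b / s ^ 2) s := by
  have := (hasDerivAt_mul_rpow (a * b) b hs).fun_div (hasDerivAt_id s) hs.ne'
  refine this.congr_deriv ?_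
  simp only [id]
  field_simp

theorem hasDerivAt_mul_rpow_mul_log (a b : ℝ) {s : ℝ} (hs : 0 < s) :
    HasDerivAt (fun s : ℝ => a * s ^ b * Real.log s)
      (a * b * s ^ b / s * Real.log s + a * s ^ b / s) s := by
  have := (hasDerivAt_mul_rpow a b hs).fun_mul (Real.hasDerivAt_log hs.ne')
  exact this.congr_deriv (by ring)

theorem hasDerivAt_mul_rpow_mul_log_deriv (a b : ℝ) {s : ℝ} (hs : 0 < s) :
    HasDerivAt (fun s : ℝ => a * b * s ^ b / s * Real.log s + a * s ^ b / s)
      (a * b * (b - 1) * s ^ b / s ^ 2 * Real.log s + a * (2 * b - 1) * s ^ b / s ^ 2) s := by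
  have h1 := (hasDerivAt_mul_rpow_div a b hs).fun_mul (Real.hasDerivAt_log hs.ne')
  have h2 := (hasDerivAt_mul_rpow a b hs).fun_div (hasDerivAt_id s) hs.ne'
  refine (h1.fun_add h2).congr_deriv ?_
  simp only [id]
  field_simp
  ring

theorem contDiffAt_mul_rpow (a b : ℝ) {s : ℝ} (hs : 0 < s) :
    ContDiffAt ℝ 2 (fun s : ℝ => a * s ^ b) s :=
  contDiffAt_const.mul (Real.contDiffAt_rpow_const (Or.inl hs.ne'))

theorem sq_rpow_half {r : ℝ} (hr : 0 ≤ r) (b : ℝ) : (r ^ 2) ^ (b / 2) = r ^ b := by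
  rw [← Real.rpow_natCast, ← Real.rpow_mul hr]
  congr 1
  push_cast
  ring

theorem abs_coord_le_norm {N : ℕ} (x : EuclideanSpace ℝ (Fin N)) (e : Fin N) : |x e| ≤ ‖x‖ := by
  simpa using PiLp.norm_apply_le x e

theorem tendsto_radialQuad {N : ℕ} (e : Fin N) {f₀ f₁ f₂ : ℝ → ℝ}
    (h₀ : Tendsto (fun r => f₀ (r ^ 2)) atTop (𝓝 0))
    (h₁ : Tendsto (fun r => f₁ (r ^ 2) * r) atTop (𝓝 0))
    (h₂ : Tendsto (fun r => f₂ (r ^ 2) * r ^ 2) atTop (𝓝 0)) :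
    Tendsto (radialQuad e f₀ f₁ f₂) (cocompact _) (𝓝 0) := by
  have h := ((h₀.abs.add h₁.abs).add h₂.abs).comp
    (tendsto_norm_cocompact_atTop (E := EuclideanSpace ℝ (Fin N)))
  simp only [abs_zero, add_zero] at h
  refine squeeze_zero_norm (fun x => ?_) h
  have hx := abs_coord_le_norm x e
  simp only [Function.comp_apply, radialQuad, Real.norm_eq_abs]
  refine (abs_add_le _ _).trans (add_le_add ((abs_add_le _ _).trans (add_le_add le_rfl ?_)) ?_)
  · rw [abs_mul, abs_mul, abs_norm]
    gcongr
  · rw [abs_mul, abs_mul, abs_pow, abs_pow, abs_norm]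
    gcongr

theorem tendsto_mul_rpow_sq_mul_pow {a b : ℝ} (m : ℕ) (hb : b < 0) :
    Tendsto (fun r : ℝ => a * (r ^ 2) ^ ((b - m) / 2) * r ^ m) atTop (𝓝 0) := by
  have h := (tendsto_rpow_neg_atTop (neg_pos.2 hb)).const_mul a
  rw [mul_zero] at h
  refine h.congr' ?_
  filter_upwards [eventually_gt_atTop 0] with r hr
  rw [sq_rpow_half hr.le, mul_assoc, ← Real.rpow_natCast r m, ← Real.rpow_add hr]
  congr 2
  ring

theorem tendsto_rpow_mul_log {b : ℝ} (hb : b < 0) :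
    Tendsto (fun r : ℝ => r ^ b * Real.log r) atTop (𝓝 0) := by
  have h := (isLittleO_log_rpow_atTop (neg_pos.2 hb)).tendsto_div_nhds_zero
  refine h.congr' ?_
  filter_upwards [eventually_gt_atTop 0] with r hr
  rw [Real.rpow_neg hr.le, div_inv_eq_mul, mul_comm]

theorem sub_mul_exponent {α k n γ : ℝ} (hk : 0 < k) (hn : 3 ≤ n) (hα : α + n - 2 < 0)
    (hγ : γ = α - 2 * k * n) : γ < 0 ∧ 2 * k * n ≤ γ * (γ + n - 2) := by
  have hkn : 0 < k * n := by positivity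
  have h1 : γ ≤ -1 := by linarith
  have h2 : γ + n - 2 ≤ -(2 * k * n) := by linarith
  refine ⟨by linarith, ?_⟩
  nlinarith

/-- The subsolution `r^α t + r^γ (Γ t² - k)`, with `t = x_e / r`, for `γ` very negative and
`Γ = γ(γ+N-2)`. -/
theorem divAgrad_subsolution_pos {N : ℕ} (hN : 3 ≤ N) (e : Fin N) {α k γ Γ : ℝ}
    (hk : 0 < k) (hkα : k * (N - 1) = α * (α + N - 2)) (hα : α + N - 2 < 0)
    (hγ : γ = α - 2 * k * N) (hΓ : Γ = γ * (γ + N - 2))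
    {x : EuclideanSpace ℝ (Fin N)} (hx : x ≠ 0) :
    0 < divAgrad (Amat k) (radialQuad e (fun s => -k * s ^ (γ / 2))
      (fun s => 1 * s ^ ((α - 1) / 2)) (fun s => Γ * s ^ ((γ - 2) / 2))) x := by
  have hn : (3 : ℝ) ≤ N := by exact_mod_cast hN
  have hs : 0 < ‖x‖ ^ 2 := by positivity
  obtain ⟨hγ0, hΓ0⟩ := sub_mul_exponent hk hn hα hγ
  rw [← hΓ] at hΓ0
  rw [divAgrad_radialQuad k e hx (contDiffAt_radialQuad e (contDiffAt_mul_rpow _ _ hs)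
    (contDiffAt_mul_rpow _ _ hs) (contDiffAt_mul_rpow _ _ hs))
    (fun s hs => hasDerivAt_mul_rpow _ _ hs) (fun s hs => hasDerivAt_mul_rpow_div _ _ hs)
    (fun s hs => hasDerivAt_mul_rpow _ _ hs) (fun s hs => hasDerivAt_mul_rpow_div _ _ hs)
    (fun s hs => hasDerivAt_mul_rpow _ _ hs) (fun s hs => hasDerivAt_mul_rpow_div _ _ hs)
    rfl rfl]
  set s := ‖x‖ ^ 2
  set z := x e
  have hY : s ^ (γ / 2) = s ^ ((γ - 2) / 2) * s := by
    rw [← Real.rpow_add_one hs.ne']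
    congr 1
    ring
  have hYpos : 0 < s ^ ((γ - 2) / 2) := Real.rpow_pos_of_pos hs _
  rw [hY]
  set Y := s ^ ((γ - 2) / 2)
  set X := s ^ ((α - 1) / 2)
  have key : 0 < Γ * Y * ((Γ - 2 * k * N) * (z ^ 2 / s) + k) := by
    have : 0 < Γ := lt_of_lt_of_le (by positivity) hΓ0
    have : 0 ≤ (Γ - 2 * k * N) * (z ^ 2 / s) := mul_nonneg (by linarith) (by positivity)
    positivity
  refine key.trans_eq ?_
  have e1 : (α - 1) * (α - 3) + 2 * (α - 1) + N * (α - 1) + (1 - k) * (N - 1) = 0 := by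
    linear_combination -hkα
  field_simp
  linear_combination (-4 * X * z) * e1 + 4 * Y * (Γ * z ^ 2 - k * s) * hΓ

theorem norm_pos_of_coord_pos {N : ℕ} {e : Fin N} {x : EuclideanSpace ℝ (Fin N)}
    (hx : 0 < x e) : 0 < ‖x‖ :=
  hx.trans_le ((le_abs_self _).trans (abs_coord_le_norm x e))

theorem ne_zero_of_coord_pos {N : ℕ} {e : Fin N} {x : EuclideanSpace ℝ (Fin N)}
    (hx : 0 < x e) : x ≠ 0 :=
  norm_pos_iff.1 (norm_pos_of_coord_pos hx)

/-- Positive supersolutions of `-div(A∇u) = 0` decay at most like `r^α` inside the cone. -/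
theorem exists_lower_bound_rpow {N : ℕ} (hN : 3 ≤ N) (e : Fin N) {α k ρ : ℝ}
    (hk : 0 < k) (hkα : k * (N - 1) = α * (α + N - 2)) (hα : α + N - 2 < 0) (hρ : 0 < ρ)
    {u : EuclideanSpace ℝ (Fin N) → ℝ}
    (hu : ContDiffOn ℝ 2 u {x | 0 < x e ∧ ρ < ‖x‖})
    (hpos : ∀ x : EuclideanSpace ℝ (Fin N), 0 < x e → ρ < ‖x‖ → 0 < u x)
    (hsup : ∀ x : EuclideanSpace ℝ (Fin N), 0 < x e → ρ < ‖x‖ →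
      0 ≤ -divAgrad (Amat k) u x) :
    ∃ c > 0, ∃ R > ρ, ∀ x : EuclideanSpace ℝ (Fin N), R ≤ ‖x‖ → ‖x‖ / N ≤ x e →
      c * ‖x‖ ^ α ≤ u x := by
  have hn : (3 : ℝ) ≤ N := by exact_mod_cast hN
  have hn0 : (0 : ℝ) < N := by linarith
  have hα0 : α < 0 := by linarith
  obtain ⟨γ, hγ⟩ : ∃ γ, γ = α - 2 * k * N := ⟨_, rfl⟩
  obtain ⟨Γ, hΓ⟩ : ∃ Γ, Γ = γ * (γ + N - 2) := ⟨_, rfl⟩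
  obtain ⟨hγ0, hΓ0⟩ := sub_mul_exponent hk hn hα hγ
  rw [← hΓ] at hΓ0
  have hΓpos : 0 < Γ := lt_of_lt_of_le (by positivity) hΓ0
  obtain ⟨s, hs, hle⟩ := supersolution_lower_bound hk.le e hρ (show ρ < ρ + 1 by linarith)
    one_pos (g := fun _ => 0) (φ := radialQuad e (fun s => -k * s ^ (γ / 2))
      (fun s => 1 * s ^ ((α - 1) / 2)) (fun s => Γ * s ^ ((γ - 2) / 2))) hu hpos
    (fun x hx => by
      have hs : 0 < ‖x‖ ^ 2 := by positivity
      exact contDiffAt_radialQuad e (contDiffAt_mul_rpow _ _ hs)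
        (contDiffAt_mul_rpow _ _ hs) (contDiffAt_mul_rpow _ _ hs))
    (tendsto_radialQuad e (by simpa using tendsto_mul_rpow_sq_mul_pow (a := -k) 0 hγ0)
      (by simpa using tendsto_mul_rpow_sq_mul_pow (a := 1) 1 hα0)
      (by simpa using tendsto_mul_rpow_sq_mul_pow (a := Γ) 2 hγ0))
    (fun x hx hx0 => by
      have hs : 0 < ‖x‖ ^ 2 := by positivity
      have := Real.rpow_pos_of_pos hs (γ / 2)
      simp only [radialQuad, hx]
      nlinarith)
    (fun _ => le_rfl)
    (fun x hx hxr => by simpa using hsup x hx (by linarith))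
    (fun x hx hxr => by
      have := divAgrad_subsolution_pos hN e hk hkα hα hγ hΓ (ne_zero_of_coord_pos hx)
      simpa using this)
  have hlim := (tendsto_rpow_neg_atTop (show (0 : ℝ) < 2 * k * N by positivity)).const_mul k
  rw [mul_zero] at hlim
  obtain ⟨R, hR⟩ := eventually_atTop.1
    (hlim.eventually (gt_mem_nhds (show (0 : ℝ) < 1 / (2 * N) by positivity)))
  refine ⟨s * (1 / (2 * N)), by positivity, max R (ρ + 1), by simp, fun x hxR hxe => ?_⟩
  have hr : 0 < ‖x‖ := by
    have := (le_max_right R (ρ + 1)).trans hxR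
    linarith
  have hxe0 : 0 < x e := lt_of_lt_of_le (by positivity) hxe
  have h1 := hle x hxe0 ((le_max_right _ _).trans hxR)
  have h2 := hR ‖x‖ ((le_max_left _ _).trans hxR)
  refine le_trans ?_ h1
  rw [mul_assoc]
  refine mul_le_mul_of_nonneg_left ?_ hs.le
  simp only [radialQuad, sq_rpow_half hr.le, one_mul]
  have hX : 0 < ‖x‖ ^ α := Real.rpow_pos_of_pos hr _
  have e1 : ‖x‖ ^ (α - 1) = ‖x‖ ^ α / ‖x‖ := by rw [Real.rpow_sub_one hr.ne']
  have e2 : ‖x‖ ^ γ = ‖x‖ ^ α * ‖x‖ ^ (-(2 * k * N)) := by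
    rw [← Real.rpow_add hr, hγ]
    rfl
  have h3 : ‖x‖ ^ α * (1 / N) ≤ ‖x‖ ^ (α - 1) * x e := by
    rw [e1]
    calc ‖x‖ ^ α * (1 / N) = ‖x‖ ^ α / ‖x‖ * (‖x‖ / N) := by field_simp
      _ ≤ ‖x‖ ^ α / ‖x‖ * x e := by gcongr
  have h4 : 0 ≤ Γ * ‖x‖ ^ (γ - 2) * x e ^ 2 := by positivity
  have h5 : k * ‖x‖ ^ γ ≤ ‖x‖ ^ α * (1 / (2 * N)) := by
    rw [e2]
    calc k * (‖x‖ ^ α * ‖x‖ ^ (-(2 * k * N))) = ‖x‖ ^ α * (k * ‖x‖ ^ (-(2 * k * N))) := by ring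
      _ ≤ _ := by gcongr
  have h6 : (1 : ℝ) / N = 1 / (2 * N) + 1 / (2 * N) := by field_simp; norm_num
  rw [h6] at h3
  linarith

/-- With a suitable correction `r^α t log r` is a subsolution of `-div(A∇u) = g` for a right-hand
side `g` of size `r^(α-2)` supported in `{t ≥ 1/N}`. -/
theorem neg_divAgrad_log_subsolution_lt {N : ℕ} (hN : 3 ≤ N) (e : Fin N) {α k γ Γ σ : ℝ}
    (hk : 0 < k) (hkα : k * (N - 1) = α * (α + N - 2)) (hα : α + N - 2 < 0)
    (hγ : γ = α - 2 * k * N) (hΓ : Γ = γ * (γ + N - 2)) (hσ : σ = -(2 * α + N - 2))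
    {x : EuclideanSpace ℝ (Fin N)} (hxe : 0 < x e) :
    -divAgrad (Amat k) (radialQuad e (fun s => -k * s ^ (γ / 2))
      (fun s => 1 / 2 * s ^ ((α - 1) / 2) * Real.log s)
      (fun s => σ / k * s ^ ((α - 2) / 2) + Γ * s ^ ((γ - 2) / 2))) x <
      if x e ≤ ‖x‖ / N then 0 else σ * N * ‖x‖ ^ (α - 2) := by
  have hn : (3 : ℝ) ≤ N := by exact_mod_cast hN
  have hx : x ≠ 0 := ne_zero_of_coord_pos hxe
  have hr : 0 < ‖x‖ := norm_pos_of_coord_pos hxe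
  have hs : 0 < ‖x‖ ^ 2 := by positivity
  have hzr : x e ≤ ‖x‖ := (le_abs_self _).trans (abs_coord_le_norm x e)
  obtain ⟨hγ0, hΓ0⟩ := sub_mul_exponent hk hn hα hγ
  rw [← hΓ] at hΓ0
  have hσ0 : 0 < σ := by linarith
  rw [divAgrad_radialQuad k e hx (contDiffAt_radialQuad e (contDiffAt_mul_rpow _ _ hs)
    ((contDiffAt_mul_rpow _ _ hs).mul (Real.contDiffAt_log.2 hs.ne'))
    ((contDiffAt_mul_rpow _ _ hs).add (contDiffAt_mul_rpow _ _ hs)))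
    (fun s hs => hasDerivAt_mul_rpow _ _ hs) (fun s hs => hasDerivAt_mul_rpow_div _ _ hs)
    (fun s hs => hasDerivAt_mul_rpow_mul_log _ _ hs)
    (fun s hs => hasDerivAt_mul_rpow_mul_log_deriv _ _ hs)
    (fun s hs => (hasDerivAt_mul_rpow _ _ hs).fun_add (hasDerivAt_mul_rpow _ _ hs))
    (fun s hs => (hasDerivAt_mul_rpow_div _ _ hs).fun_add (hasDerivAt_mul_rpow_div _ _ hs))
    rfl rfl]
  have hY : (‖x‖ ^ 2) ^ (γ / 2) = ‖x‖ ^ (γ - 2) * ‖x‖ ^ 2 := by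
    rw [sq_rpow_half hr.le, ← Real.rpow_natCast ‖x‖ 2, ← Real.rpow_add hr]
    congr 1
    push_cast
    ring
  have hX : (‖x‖ ^ 2) ^ ((α - 1) / 2) = ‖x‖ ^ (α - 2) * ‖x‖ := by
    rw [sq_rpow_half hr.le, ← Real.rpow_add_one hr.ne']
    congr 1
    ring
  rw [hY, hX, sq_rpow_half hr.le (α - 2), sq_rpow_half hr.le (γ - 2)]
  have hYpos : 0 < ‖x‖ ^ (γ - 2) := Real.rpow_pos_of_pos hr _
  have hWpos : 0 < ‖x‖ ^ (α - 2) := Real.rpow_pos_of_pos hr _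
  set Y := ‖x‖ ^ (γ - 2)
  set W := ‖x‖ ^ (α - 2)
  set l := Real.log (‖x‖ ^ 2)
  clear_value Y W l
  generalize x e = z at *
  generalize ‖x‖ = r at *
  obtain ⟨t, rfl⟩ : ∃ t, z = t * r := ⟨z / r, by field_simp⟩
  have ht0 : 0 < t := pos_of_mul_pos_left hxe hr.le
  have ht1 : t ≤ 1 := by
    by_contra! h
    nlinarith
  have key : 0 < Γ * Y * ((Γ - 2 * k * N) * t ^ 2 + k) := by
    have : 0 < Γ := lt_of_lt_of_le (by positivity) hΓ0
    have : 0 ≤ (Γ - 2 * k * N) * t ^ 2 := mul_nonneg (by linarith) (by positivity)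
    positivity
  have hif : -(W * σ * (2 - (N + 1) * t ^ 2 - t)) ≤
      if t * r ≤ r / N then 0 else σ * N * W := by
    have hWσ : 0 < W * σ := by positivity
    split_ifs with h
    · have h1 : t * N ≤ 1 := by
        rw [le_div_iff₀ (by linarith)] at h
        by_contra! h'
        nlinarith
      have h2 : t ≤ 1 / 3 := by nlinarith
      have h3 : 0 ≤ 2 - (N + 1) * t ^ 2 - t := by nlinarith
      have := mul_nonneg hWσ.le h3
      linarith
    · have h3 : 0 ≤ N + (2 - (N + 1) * t ^ 2 - t) := by
        nlinarith [mul_nonneg (show (0 : ℝ) ≤ N + 1 by linarith)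
          (show 0 ≤ 1 - t ^ 2 by nlinarith)]
      have := mul_nonneg hWσ.le h3
      linarith
  refine lt_of_lt_of_le ?_ hif
  rw [neg_lt_neg_iff]
  refine lt_of_lt_of_eq (lt_add_of_pos_right _ key) ?_
  have e1 : (α - 1) * (α - 3) + 2 * (α - 1) + N * (α - 1) + (1 - k) * (N - 1) = 0 := by
    linear_combination -hkα
  field_simp
  linear_combination (-4 * k * W * t * l) * e1 - 8 * k * W * t * hσ +
    8 * W * σ * t ^ 2 * hkα + 8 * k * Y * (t ^ 2 * Γ - k) * hΓ

/-- Positive solutions of `-div(A∇u) ≥ u^q` with `1 < q ≤ p` would eventually exceed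
every multiple of `r^α` inside the cone. -/
theorem eventually_mul_rpow_le {N : ℕ} (hN : 3 ≤ N) (e : Fin N) {α k ρ q : ℝ}
    (hk : 0 < k) (hkα : k * (N - 1) = α * (α + N - 2)) (hα : α + N - 2 < 0) (hρ : 0 < ρ)
    (hq : 1 < q) (hαq : -2 ≤ α * (q - 1))
    {u : EuclideanSpace ℝ (Fin N) → ℝ}
    (hu : ContDiffOn ℝ 2 u {x | 0 < x e ∧ ρ < ‖x‖})
    (hpos : ∀ x : EuclideanSpace ℝ (Fin N), 0 < x e → ρ < ‖x‖ → 0 < u x)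
    (hsup : ∀ x : EuclideanSpace ℝ (Fin N), 0 < x e → ρ < ‖x‖ →
      u x ^ q ≤ -divAgrad (Amat k) u x) (M : ℝ) :
    ∀ᶠ R in atTop, ∀ x : EuclideanSpace ℝ (Fin N), R ≤ ‖x‖ → ‖x‖ / N ≤ x e →
      M * ‖x‖ ^ α ≤ u x := by
  have hn : (3 : ℝ) ≤ N := by exact_mod_cast hN
  have hn0 : (0 : ℝ) < N := by linarith
  have hα0 : α < 0 := by linarith
  obtain ⟨c, hc, R₁, hR₁, hlow⟩ := exists_lower_bound_rpow hN e hk hkα hα hρ hu hpos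
    (fun x hx hxr => (Real.rpow_nonneg (hpos x hx hxr).le q).trans (hsup x hx hxr))
  obtain ⟨γ, hγ⟩ : ∃ γ, γ = α - 2 * k * N := ⟨_, rfl⟩
  obtain ⟨Γ, hΓ⟩ : ∃ Γ, Γ = γ * (γ + N - 2) := ⟨_, rfl⟩
  obtain ⟨σ, hσ⟩ : ∃ σ, σ = -(2 * α + N - 2) := ⟨_, rfl⟩
  obtain ⟨hγ0, hΓ0⟩ := sub_mul_exponent hk hn hα hγ
  rw [← hΓ] at hΓ0
  have hΓpos : 0 < Γ := lt_of_lt_of_le (by positivity) hΓ0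
  have hσ0 : 0 < σ := by linarith
  set r₀ := max R₁ 1
  have hr₀ : 1 ≤ r₀ := le_max_right _ _
  have hρr : ρ < r₀ := hR₁.trans_le (le_max_left _ _)
  obtain ⟨s, hs, hle⟩ := supersolution_lower_bound hk.le e hρ hρr
    (show 0 < c ^ q / (σ * N) by positivity)
    (g := fun x => if x e ≤ ‖x‖ / N then 0 else σ * N * ‖x‖ ^ (α - 2))
    (φ := radialQuad e (fun s => -k * s ^ (γ / 2))
      (fun s => 1 / 2 * s ^ ((α - 1) / 2) * Real.log s)
      (fun s => σ / k * s ^ ((α - 2) / 2) + Γ * s ^ ((γ - 2) / 2))) hu hpos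
    (fun x hx => by
      have hs : 0 < ‖x‖ ^ 2 := by positivity
      exact contDiffAt_radialQuad e (contDiffAt_mul_rpow _ _ hs)
        ((contDiffAt_mul_rpow _ _ hs).mul (Real.contDiffAt_log.2 hs.ne'))
        ((contDiffAt_mul_rpow _ _ hs).add (contDiffAt_mul_rpow _ _ hs)))
    (tendsto_radialQuad e (by simpa using tendsto_mul_rpow_sq_mul_pow (a := -k) 0 hγ0)
      (by
        refine (tendsto_rpow_mul_log hα0).congr' ?_
        filter_upwards [eventually_gt_atTop 0] with r hr
        rw [sq_rpow_half hr.le, Real.rpow_sub_one hr.ne', Real.log_pow]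
        push_cast
        field_simp)
      (by
        have := (tendsto_mul_rpow_sq_mul_pow (a := σ / k) 2 hα0).add
          (tendsto_mul_rpow_sq_mul_pow (a := Γ) 2 hγ0)
        simpa [add_mul] using this))
    (fun x hx hx0 => by
      have hs : 0 < ‖x‖ ^ 2 := by positivity
      have := Real.rpow_pos_of_pos hs (γ / 2)
      simp only [radialQuad, hx]
      nlinarith)
    (fun x => by
      dsimp only
      split_ifs
      · exact le_rfl
      · positivity)
    (fun x hx hxr => by
      refine le_trans ?_ (hsup x hx (hρr.trans hxr))
      have hux := hpos x hx (hρr.trans hxr)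
      dsimp only
      split_ifs with h
      · rw [mul_zero]
        exact Real.rpow_nonneg hux.le q
      · have hr1 : 1 ≤ ‖x‖ := hr₀.trans hxr.le
        have hr : 0 < ‖x‖ := by linarith
        have h1 := hlow x ((le_max_left _ _).trans hxr.le) (not_le.1 h).le
        calc c ^ q / (σ * N) * (σ * N * ‖x‖ ^ (α - 2)) = c ^ q * ‖x‖ ^ (α - 2) := by field_simp
          _ ≤ c ^ q * ‖x‖ ^ (α * q) := by
            gcongr
            linarith
          _ = (c * ‖x‖ ^ α) ^ q := by
            rw [Real.mul_rpow hc.le (Real.rpow_nonneg hr.le _), Real.rpow_mul hr.le]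
          _ ≤ u x ^ q := by gcongr)
    (fun x hx _ => neg_divAgrad_log_subsolution_lt hN e hk hkα hα hγ hΓ hσ hx)
  have hlog : ∀ᶠ r in atTop, N * (k + M / s) ≤ Real.log r :=
    Real.tendsto_log_atTop.eventually_ge_atTop _
  filter_upwards [eventually_ge_atTop r₀, (eventually_forall_ge_atTop.2 hlog)] with R hR hRlog
  intro x hxR hxe
  have hr1 : 1 ≤ ‖x‖ := hr₀.trans (hR.trans hxR)
  have hr : 0 < ‖x‖ := by linarith
  have hxe0 : 0 < x e := lt_of_lt_of_le (by positivity) hxe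
  have h1 := hle x hxe0 (hR.trans hxR)
  have h2 := hRlog ‖x‖ hxR
  have hX : 0 < ‖x‖ ^ α := Real.rpow_pos_of_pos hr _
  have hl0 : 0 ≤ Real.log ‖x‖ := Real.log_nonneg hr1
  refine le_trans ?_ h1
  simp only [radialQuad, sq_rpow_half hr.le, Real.log_pow]
  have h3 : ‖x‖ ^ α * (k + M / s) ≤ ‖x‖ ^ (α - 1) * Real.log ‖x‖ * x e := by
    rw [Real.rpow_sub_one hr.ne']
    calc ‖x‖ ^ α * (k + M / s) ≤ ‖x‖ ^ α * (Real.log ‖x‖ / N) := by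
          gcongr
          rw [le_div_iff₀ hn0]
          linarith
      _ = ‖x‖ ^ α / ‖x‖ * Real.log ‖x‖ * (‖x‖ / N) := by field_simp
      _ ≤ _ := by gcongr
  have h4 : ‖x‖ ^ γ ≤ ‖x‖ ^ α := by
    have : 0 < k * N := by positivity
    exact Real.rpow_le_rpow_of_exponent_le hr1 (by linarith)
  have h5 : 0 ≤ (σ / k * ‖x‖ ^ (α - 2) + Γ * ‖x‖ ^ (γ - 2)) * x e ^ 2 := by positivity
  have h6 := mul_le_mul_of_nonneg_left h4 hk.le
  have h7 : M * ‖x‖ ^ α = s * (‖x‖ ^ α * (M / s)) := by field_simp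
  rw [h7]
  refine mul_le_mul_of_nonneg_left ?_ hs.le
  push_cast
  linarith

/-- Lower bound for `div(A∇(w²))` where `w = R² - ‖x - 2R e‖²`. -/
theorem divAgrad_ball_sq_ge {N : ℕ} (hN : 3 ≤ N) (e : Fin N) {k R : ℝ} (hk : 0 < k) (hR : 0 < R)
    {x : EuclideanSpace ℝ (Fin N)} (hxR : R ≤ ‖x‖) (hxe : 0 ≤ x e) {w : ℝ}
    (hw : w = 4 * R * x e - ‖x‖ ^ 2 - 3 * R ^ 2) (hw0 : 0 ≤ w) :
    8 * min k 1 * R ^ 2 - (8 * min k 1 + 2 * (2 * k * N + (1 + k) * (6 * N))) * w ≤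
      divAgrad (Amat k) (radialQuad e (fun s => (s + 3 * R ^ 2) ^ 2)
        (fun s => -8 * R * (s + 3 * R ^ 2)) (fun _ => 16 * R ^ 2)) x := by
  have hn : (3 : ℝ) ≤ N := by exact_mod_cast hN
  have hr : 0 < ‖x‖ := hR.trans_le hxR
  have hx : x ≠ 0 := norm_pos_iff.1 hr
  have hs : 0 < ‖x‖ ^ 2 := by positivity
  have hzr : x e ≤ ‖x‖ := (le_abs_self _).trans (abs_coord_le_norm x e)
  rw [divAgrad_radialQuad k e hx (contDiffAt_radialQuad e (by fun_prop) (by fun_prop)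
    (by fun_prop)) (f₀' := fun s => 2 * (s + 3 * R ^ 2)) (f₀'' := fun _ => 2)
    (f₁' := fun _ => -8 * R) (f₁'' := fun _ => 0) (f₂' := fun _ => 0) (f₂'' := fun _ => 0)
    (fun s _ => by simpa using ((hasDerivAt_id s).add_const (3 * R ^ 2)).fun_pow 2)
    (fun s _ => by simpa using ((hasDerivAt_id s).add_const (3 * R ^ 2)).const_mul 2)
    (fun s _ => by simpa using ((hasDerivAt_id s).add_const (3 * R ^ 2)).const_mul (-8 * R))
    (fun s _ => hasDerivAt_const _ _) (fun s _ => hasDerivAt_const _ _)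
    (fun s _ => hasDerivAt_const _ _) rfl rfl]
  generalize x e = z at *
  generalize ‖x‖ = r at *
  obtain ⟨y, rfl⟩ : ∃ y, z = y * r := ⟨z / r, by field_simp⟩
  have hy0 : 0 ≤ y := by
    by_contra! h
    nlinarith
  have hy1 : y ≤ 1 := by
    by_contra! h
    nlinarith
  obtain ⟨τ, rfl⟩ : ∃ τ, R = τ * r := ⟨R / r, by field_simp⟩
  have hτ0 : 0 < τ := pos_of_mul_pos_left hR hr.le
  have hτ1 : τ ≤ 1 := by
    by_contra! h
    nlinarith
  set κ := min k 1
  set B := 2 * k * N + (1 + k) * (6 * N)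
  have hexp : (4 * r ^ 2 * 2 + 2 * N * (2 * (r ^ 2 + 3 * (τ * r) ^ 2))) +
      y * r * (4 * r ^ 2 * 0 + 4 * (-8 * (τ * r)) + 2 * N * (-8 * (τ * r)) +
        (1 - k) * (N - 1) * (-8 * (τ * r) * (r ^ 2 + 3 * (τ * r) ^ 2)) / r ^ 2) +
      ((y * r) ^ 2 * (4 * r ^ 2 * 0 + 8 * 0 + 2 * N * 0 +
        (1 - k) * (2 * N) * (16 * (τ * r) ^ 2) / r ^ 2) + 2 * k * (16 * (τ * r) ^ 2)) =
      2 * w * (-2 * k * N + (1 - k) * (-2 * N + 4 * (N - 1) * (τ * y))) +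
      8 * (k * ((τ * r) ^ 2 - w) + (1 - k) * (r * (2 * τ * y - 1)) ^ 2) := by
    rw [hw]
    field_simp
    ring
  rw [hexp]
  have hty0 : 0 ≤ τ * y := by positivity
  have hty1 : τ * y ≤ 1 := by nlinarith
  have hL : -B ≤ -2 * k * N + (1 - k) * (-2 * N + 4 * (N - 1) * (τ * y)) := by
    have h1 : |(1 - k) * (-2 * N + 4 * (N - 1) * (τ * y))| ≤ (1 + k) * (6 * N) := by
      rw [abs_mul]
      gcongr
      · exact abs_le.2 ⟨by linarith, by linarith⟩
      · exact abs_le.2 ⟨by nlinarith, by nlinarith⟩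
    have := (abs_le.1 h1).1
    simp only [B]
    linarith
  have hG : κ * ((τ * r) ^ 2 - w) ≤
      k * ((τ * r) ^ 2 - w) + (1 - k) * (r * (2 * τ * y - 1)) ^ 2 := by
    have h1 : (r * (2 * τ * y - 1)) ^ 2 ≤ (τ * r) ^ 2 - w := by
      rw [hw]
      have : 0 ≤ (τ * r) ^ 2 * (1 - y ^ 2) := mul_nonneg (sq_nonneg _) (by nlinarith)
      nlinarith
    have h2 : 0 ≤ (r * (2 * τ * y - 1)) ^ 2 := sq_nonneg _
    rcases le_total k 1 with h | h
    · rw [show κ = k from min_eq_left h]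
      nlinarith [mul_nonneg (sub_nonneg.2 h) h2]
    · rw [show κ = 1 from min_eq_right h]
      nlinarith [mul_nonneg (sub_nonneg.2 h) (sub_nonneg.2 h1)]
  have := mul_le_mul_of_nonneg_left hL hw0
  linarith

theorem sub_add_sq_div_pos {A : ℝ} (hA : 0 < A) (t : ℝ) : 0 < A - t + t ^ 2 / A := by
  have : A - t + t ^ 2 / A = ((t - A / 2) ^ 2 + 3 / 4 * A ^ 2) / A := by
    field_simp
    ring
  rw [this]
  positivity

/-- For `1 < q ≤ p` there is no positive supersolution at infinity. -/
theorem not_exists_supersolution {N : ℕ} (hN : 3 ≤ N) (e : Fin N) {α k ρ q : ℝ}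
    (hk : 0 < k) (hkα : k * (N - 1) = α * (α + N - 2)) (hα : α + N - 2 < 0) (hρ : 0 < ρ)
    (hq : 1 < q) (hαq : -2 ≤ α * (q - 1))
    {u : EuclideanSpace ℝ (Fin N) → ℝ}
    (hu : ContDiffOn ℝ 2 u {x | 0 < x e ∧ ρ < ‖x‖})
    (hpos : ∀ x : EuclideanSpace ℝ (Fin N), 0 < x e → ρ < ‖x‖ → 0 < u x)
    (hsup : ∀ x : EuclideanSpace ℝ (Fin N), 0 < x e → ρ < ‖x‖ →
      u x ^ q ≤ -divAgrad (Amat k) u x) : False := by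
  have hn : (3 : ℝ) ≤ N := by exact_mod_cast hN
  obtain ⟨B, hB⟩ : ∃ B, B = 8 * min k 1 + 2 * (2 * k * N + (1 + k) * (6 * N)) := ⟨_, rfl⟩
  have hκ : 0 < min k 1 := lt_min hk one_pos
  have hB0 : 0 < B := by rw [hB]; positivity
  obtain ⟨a, ha⟩ : ∃ a, a = 8 * min k 1 := ⟨_, rfl⟩
  have ha0 : 0 < a := by rw [ha]; positivity
  obtain ⟨Q, hQ⟩ : ∃ Q, Q = 9 * B ^ 2 / a := ⟨_, rfl⟩
  have hQ0 : 0 < Q := by rw [hQ]; positivity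
  obtain ⟨M, hM0, hM⟩ : ∃ M > 0, M ^ (q - 1) = Q :=
    ⟨Q ^ (q - 1)⁻¹, Real.rpow_pos_of_pos hQ0 _,
      Real.rpow_inv_rpow hQ0.le (by linarith)⟩
  obtain ⟨R, hlow, hR⟩ := ((eventually_mul_rpow_le hN e hk hkα hα hρ hq hαq hu hpos hsup M).and
    (eventually_ge_atTop (ρ + 1))).exists
  have hR1 : 1 ≤ R := by linarith
  have hR0 : 0 < R := by linarith
  let w : EuclideanSpace ℝ (Fin N) → ℝ := fun x => 4 * R * x e - ‖x‖ ^ 2 - 3 * R ^ 2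
  have hwc : Continuous w :=
    ((continuous_const.mul (EuclideanSpace.proj (𝕜 := ℝ) e).continuous).sub
      (continuous_norm.pow 2)).sub continuous_const
  have hgeom : ∀ x, 0 ≤ w x → R ≤ ‖x‖ ∧ ‖x‖ ≤ 3 * R ∧ 0 < x e ∧ ‖x‖ / N ≤ x e := by
    intro x hx
    have hx : 0 ≤ 4 * R * x e - ‖x‖ ^ 2 - 3 * R ^ 2 := hx
    have h1 : x e ≤ ‖x‖ := (le_abs_self _).trans (abs_coord_le_norm x e)
    have h2 : 0 ≤ (‖x‖ - R) * (3 * R - ‖x‖) := by nlinarith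
    have h0 := norm_nonneg x
    have h3 : R ≤ ‖x‖ := by
      by_contra! h
      nlinarith
    have h4 : ‖x‖ ≤ 3 * R := by
      by_contra! h
      nlinarith
    have h5 : 0 < x e := by
      by_contra! h
      nlinarith
    refine ⟨h3, h4, h5, ?_⟩
    have h6 : ‖x‖ ≤ 3 * x e := by
      have : 4 * R * ‖x‖ ≤ 4 * R * (3 * x e) := by nlinarith [sq_nonneg (‖x‖ - R)]
      exact le_of_mul_le_mul_left this (by positivity)
    rw [div_le_iff₀ (by linarith)]
    nlinarith
  have hKcpt : IsCompact {x | 0 ≤ w x} :=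
    (isCompact_closedBall 0 (3 * R)).of_isClosed_subset (isClosed_le continuous_const hwc)
      fun x hx => by simpa using (hgeom x hx).2.1
  have hφw : ∀ x, radialQuad e (fun s => (s + 3 * R ^ 2) ^ 2)
      (fun s => -8 * R * (s + 3 * R ^ 2)) (fun _ => 16 * R ^ 2) x = w x ^ 2 := by
    intro x
    simp only [radialQuad, w]
    ring
  have hyw : w (EuclideanSpace.single e (2 * R)) = R ^ 2 := by
    simp only [w, PiLp.norm_single, PiLp.single_apply, if_true, Real.norm_eq_abs, sq_abs]
    ring
  refine not_exists_strict_subsolution hk.le hKcpt (u := u) (V := fun x => Q / ‖x‖ ^ 2)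
    (φ := radialQuad e (fun s => (s + 3 * R ^ 2) ^ 2)
      (fun s => -8 * R * (s + 3 * R ^ 2)) (fun _ => 16 * R ^ 2))
    (y := EuclideanSpace.single e (2 * R)) ?_ ?_ ?_ ?_ ?_ ?_ ?_ ?_ ?_
  · exact fun x hx => ne_zero_of_coord_pos (hgeom x hx).2.2.1
  · intro x hx
    obtain ⟨h1, -, h2, -⟩ := hgeom x hx
    exact hu.contDiffAt ((isOpen_cone_inter_exterior e ρ).mem_nhds ⟨h2, by linarith⟩)
  · exact fun x _ => contDiffAt_radialQuad e (by fun_prop) (by fun_prop) (by fun_prop)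
  · intro x hx
    obtain ⟨h1, -, h2, -⟩ := hgeom x hx
    exact hpos x h2 (by linarith)
  · intro x hx hφx
    rw [hφw] at hφx
    have hwx : 0 < w x := lt_of_le_of_ne hx fun h => by simp [← h] at hφx
    filter_upwards [hwc.continuousAt.eventually (lt_mem_nhds hwx)] with z hz
    exact hz.le
  · rw [Set.mem_ofPred_eq, hyw]
    positivity
  · rw [hφw, hyw]
    positivity
  · intro x hx
    obtain ⟨h1, -, h2, h3⟩ := hgeom x hx
    have hux := hpos x h2 (by linarith)
    have hr : 0 < ‖x‖ := by linarith
    refine le_trans ?_ (hsup x h2 (by linarith))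
    have hsplit : u x ^ q = u x ^ (q - 1) * u x := by
      rw [Real.rpow_sub_one hux.ne']
      field_simp
    rw [hsplit]
    refine mul_le_mul_of_nonneg_right ?_ hux.le
    have h4 : 0 ≤ M * ‖x‖ ^ α := by positivity
    calc Q / ‖x‖ ^ 2 = Q * ‖x‖ ^ (-2 : ℝ) := by
          rw [Real.rpow_neg hr.le, div_eq_mul_inv]
          norm_cast
      _ ≤ Q * ‖x‖ ^ (α * (q - 1)) := by
          gcongr
          linarith
      _ = (M * ‖x‖ ^ α) ^ (q - 1) := by
          rw [Real.mul_rpow hM0.le (Real.rpow_nonneg hr.le _), Real.rpow_mul hr.le, hM]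
      _ ≤ u x ^ (q - 1) := Real.rpow_le_rpow h4 (hlow x h1 h3) (by linarith)
  · intro x hx _
    obtain ⟨h1, h2, h3, -⟩ := hgeom x hx
    have hr : 0 < ‖x‖ := by linarith
    have h4 := divAgrad_ball_sq_ge hN e hk hR0 h1 h3.le (w := w x) rfl hx
    rw [← hB, ← ha] at h4
    rw [hφw]
    have h5 : B ^ 2 / (a * R ^ 2) ≤ Q / ‖x‖ ^ 2 := by
      rw [hQ, div_div, div_le_div_iff₀ (by positivity) (by positivity)]
      have : ‖x‖ ^ 2 ≤ 9 * R ^ 2 := by nlinarith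
      have : B ^ 2 * a * ‖x‖ ^ 2 ≤ B ^ 2 * a * (9 * R ^ 2) := by gcongr
      linarith
    have h6 := mul_le_mul_of_nonneg_right h5 (sq_nonneg (w x))
    have h7 := sub_add_sq_div_pos (show 0 < a * R ^ 2 by positivity) (B * w x)
    have h8 : (B * w x) ^ 2 / (a * R ^ 2) = B ^ 2 / (a * R ^ 2) * w x ^ 2 := by ring
    linarith

/-- For `q > p` the function `c r^γ t`, with `t = x_e / r` and `γ = -2/(q-1)`, is a positive
supersolution. -/
theorem exists_supersolution_s16 {N : ℕ} (hN : 3 ≤ N) (e : Fin N) {α k q : ℝ}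
    (hkα : k * (N - 1) = α * (α + N - 2)) (hα : α + N - 2 < 0)
    (hq : 1 < q) (hαq : α * (q - 1) < -2) :
    ∃ u : EuclideanSpace ℝ (Fin N) → ℝ,
      (∀ x : EuclideanSpace ℝ (Fin N), x ≠ 0 → ContDiffAt ℝ 2 u x) ∧
      (∀ x : EuclideanSpace ℝ (Fin N), 0 < x e → 0 < u x) ∧
      (∀ x : EuclideanSpace ℝ (Fin N), 0 < x e → u x ^ q ≤ -divAgrad (Amat k) u x) := by
  have hn : (3 : ℝ) ≤ N := by exact_mod_cast hN
  have hq1 : 0 < q - 1 := by linarith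
  obtain ⟨γ, hγ⟩ : ∃ γ, γ = -2 / (q - 1) := ⟨_, rfl⟩
  have hγq : γ * q = γ - 2 := by
    rw [hγ]
    field_simp
    ring
  have hγ0 : γ < 0 := by
    rw [hγ]
    exact div_neg_of_neg_of_pos (by norm_num) hq1
  have hαγ : α < γ := by
    rw [hγ, lt_div_iff₀ hq1]
    exact hαq
  obtain ⟨m, hm⟩ : ∃ m, m = k * (N - 1) - γ * (γ + N - 2) := ⟨_, rfl⟩
  have hm0 : 0 < m := by
    rw [hm, hkα]
    nlinarith
  obtain ⟨c, hc0, hc⟩ : ∃ c > 0, c ^ (q - 1) = m :=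
    ⟨m ^ (q - 1)⁻¹, Real.rpow_pos_of_pos hm0 _, Real.rpow_inv_rpow hm0.le hq1.ne'⟩
  have hsm : ∀ x : EuclideanSpace ℝ (Fin N), x ≠ 0 → ContDiffAt ℝ 2
      (radialQuad e (fun _ => 0) (fun s => c * s ^ ((γ - 1) / 2)) (fun _ => 0)) x :=
    fun x hx => contDiffAt_radialQuad e contDiffAt_const
      (contDiffAt_mul_rpow _ _ (by positivity)) contDiffAt_const
  refine ⟨radialQuad e (fun _ => 0) (fun s => c * s ^ ((γ - 1) / 2)) (fun _ => 0), hsm,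
    fun x hx => ?_, fun x hx => ?_⟩
  · have hr := norm_pos_of_coord_pos hx
    simp only [radialQuad]
    positivity
  · have hr := norm_pos_of_coord_pos hx
    have hx0 := ne_zero_of_coord_pos hx
    rw [divAgrad_radialQuad k e hx0 (hsm x hx0)
      (fun s _ => hasDerivAt_const _ _) (fun s _ => hasDerivAt_const _ _)
      (fun s hs => hasDerivAt_mul_rpow _ _ hs) (fun s hs => hasDerivAt_mul_rpow_div _ _ hs)
      (fun s _ => hasDerivAt_const _ _) (fun s _ => hasDerivAt_const _ _) rfl rfl]
    have hzr : x e ≤ ‖x‖ := (le_abs_self _).trans (abs_coord_le_norm x e)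
    simp only [radialQuad, sq_rpow_half hr.le]
    generalize ‖x‖ = r at *
    generalize x e = z at *
    have hX : 0 < r ^ γ := Real.rpow_pos_of_pos hr _
    have ht0 : 0 < z / r := by positivity
    have ht1 : z / r ≤ 1 := (div_le_one hr).2 hzr
    have hu : 0 + c * r ^ (γ - 1) * z + 0 * z ^ 2 = c * r ^ γ * (z / r) := by
      rw [Real.rpow_sub_one hr.ne']
      field_simp
      ring
    rw [hu, Real.mul_rpow (by positivity) ht0.le, Real.mul_rpow hc0.le hX.le,
      ← Real.rpow_mul hr.le, hγq]
    have hcq : c ^ q = c * m := by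
      rw [← hc, Real.rpow_sub_one hc0.ne']
      field_simp
    have htq : (z / r) ^ q ≤ z / r := by
      simpa using Real.rpow_le_rpow_of_exponent_ge ht0 ht1 hq.le
    calc c ^ q * r ^ (γ - 2) * (z / r) ^ q ≤ c ^ q * r ^ (γ - 2) * (z / r) := by gcongr
      _ = _ := by
        rw [hcq, hm, Real.rpow_sub_one hr.ne', show γ - 2 = γ - 1 - 1 by ring,
          Real.rpow_sub_one hr.ne', Real.rpow_sub_one hr.ne']
        field_simp
        ring

theorem Amat_quadratic {N : ℕ} (k : ℝ) (x ξ : EuclideanSpace ℝ (Fin N)) :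
    ∑ i, ∑ j, ξ i * Amat k x i j * ξ j =
      k * ‖ξ‖ ^ 2 + (1 - k) * (inner ℝ x ξ ^ 2 / ‖x‖ ^ 2) := by
  have h1 : ∀ i j, ξ i * Amat k x i j * ξ j =
      k * (if i = j then ξ i * ξ j else 0) +
        (1 - k) / ‖x‖ ^ 2 * ((x i * ξ i) * (x j * ξ j)) := by
    intro i j
    simp only [Amat, Matrix.of_apply]
    split_ifs <;> ring
  have h2 : inner ℝ x ξ = ∑ i, x i * ξ i := by
    simp [PiLp.inner_apply, mul_comm]
  simp_rw [h1, Finset.sum_add_distrib, ← Finset.mul_sum, ← Finset.sum_mul, ← h2]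
  simp only [Finset.sum_ite_eq, Finset.mem_univ, if_true]
  rw [sum_coord_sq]
  ring

theorem Amat_elliptic {N : ℕ} {k : ℝ} (hk : 0 < k) {x : EuclideanSpace ℝ (Fin N)} (hx : x ≠ 0)
    (ξ : EuclideanSpace ℝ (Fin N)) :
    (max k k⁻¹)⁻¹ * ‖ξ‖ ^ 2 ≤ ∑ i, ∑ j, ξ i * Amat k x i j * ξ j ∧
      ∑ i, ∑ j, ξ i * Amat k x i j * ξ j ≤ (max k k⁻¹) * ‖ξ‖ ^ 2 := by
  rw [Amat_quadratic]
  have hs : 0 < ‖x‖ ^ 2 := by positivity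
  have hy0 : 0 ≤ inner ℝ x ξ ^ 2 / ‖x‖ ^ 2 := by positivity
  have hy1 : inner ℝ x ξ ^ 2 / ‖x‖ ^ 2 ≤ ‖ξ‖ ^ 2 := by
    rw [div_le_iff₀ hs, ← mul_pow, mul_comm ‖ξ‖]
    exact sq_le_sq' (neg_le_of_abs_le (abs_real_inner_le_norm x ξ)) (real_inner_le_norm x ξ)
  generalize inner ℝ x ξ ^ 2 / ‖x‖ ^ 2 = y at *
  generalize ‖ξ‖ ^ 2 = t at *
  have hki : k * k⁻¹ = 1 := mul_inv_cancel₀ hk.ne'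
  rcases le_total k 1 with h | h
  · have h1 : 1 ≤ k⁻¹ := (one_le_inv₀ hk).2 h
    rw [max_eq_right (h.trans h1), inv_inv]
    constructor <;> nlinarith
  · have h1 : k⁻¹ ≤ 1 := inv_le_one_of_one_le₀ h
    rw [max_eq_left (h1.trans h)]
    constructor <;> nlinarith

end

/-- Theorem 1.4: for every `p ∈ (1, N/(N-2))` the matrix field `A_p` is symmetric and
uniformly elliptic (with constant `ν = max(k, 1/k)`), and the set of exponents `q > 1`
for which `-div(A_p∇u) = u^q` has a positive supersolution at infinity in the half-space
cone `C₊` is exactly `(p, ∞)`; in particular the critical exponent equals `p` and is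
not attained. -/
theorem critical_exponent_prescribed
    (N : ℕ) (hN : 3 ≤ N) (p : ℝ) (hp : p ∈ Set.Ioo 1 ((N : ℝ) / ((N : ℝ) - 2)))
    (α k : ℝ) (hα : α = -2 / (p - 1)) (hk : k = α * (α + (N : ℝ) - 2) / ((N : ℝ) - 1)) :
    (∀ x : EuclideanSpace ℝ (Fin N), x ≠ 0 →
      (∀ i j, Amat k x i j = Amat k x j i) ∧
      ∀ ξ : EuclideanSpace ℝ (Fin N),
        (max k k⁻¹)⁻¹ * ‖ξ‖ ^ 2 ≤ ∑ i, ∑ j, ξ i * Amat k x i j * ξ j ∧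
        ∑ i, ∑ j, ξ i * Amat k x i j * ξ j ≤ (max k k⁻¹) * ‖ξ‖ ^ 2) ∧
    (let S : Set ℝ := {q | 1 < q ∧ ∃ ρ : ℝ, 0 < ρ ∧ ∃ u : EuclideanSpace ℝ (Fin N) → ℝ,
        ContDiffOn ℝ 2 u {x | 0 < lastCoord x ∧ ρ < ‖x‖} ∧
        (∀ x : EuclideanSpace ℝ (Fin N), 0 < lastCoord x → ρ < ‖x‖ → 0 < u x) ∧
        (∀ x : EuclideanSpace ℝ (Fin N), 0 < lastCoord x → ρ < ‖x‖ →
          -divAgrad (Amat k) u x ≥ u x ^ q)};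
      S = {q : ℝ | p < q} ∧ sInf S = p ∧ p ∉ S) := by
  have hn : (3 : ℝ) ≤ N := by exact_mod_cast hN
  obtain ⟨hp1, hp2⟩ := hp
  have hp0 : 0 < p - 1 := by linarith
  have hαp : α * (p - 1) = -2 := by
    rw [hα]
    field_simp
  have hα0 : α < 0 := by nlinarith
  have hαn : α + N - 2 < 0 := by
    rw [lt_div_iff₀ (by linarith)] at hp2
    nlinarith
  have hk0 : 0 < k := by
    rw [hk]
    exact div_pos (mul_pos_of_neg_of_neg hα0 hαn) (by linarith)
  have hkα : k * (N - 1) = α * (α + N - 2) := by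
    rw [hk]
    exact div_mul_cancel₀ _ (by linarith)
  have hN0 : 0 < N := by omega
  obtain ⟨e, he⟩ : ∃ e : Fin N, ∀ x : EuclideanSpace ℝ (Fin N), lastCoord x = x e :=
    ⟨⟨N - 1, Nat.sub_lt hN0 Nat.one_pos⟩, fun x => dif_pos hN0⟩
  refine ⟨fun x hx => ⟨fun i j => ?_, Amat_elliptic hk0 hx⟩, ?_⟩
  · simp only [Amat, Matrix.of_apply, eq_comm (a := i), mul_comm (x i)]
  intro S
  have hS : S = {q : ℝ | p < q} := by
    ext q
    simp only [S, he]
    constructor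
    · rintro ⟨hq, ρ, hρ, u, hu, hpos, hsup⟩
      by_contra h
      have hqp : q ≤ p := not_lt.1 h
      exact not_exists_supersolution hN e hk0 hkα hαn hρ hq (by nlinarith) hu hpos hsup
    · intro h
      have hqp : p < q := h
      obtain ⟨u, hu, hpos, hsup⟩ :=
        exists_supersolution_s16 hN e hkα hαn (hp1.trans hqp) (by nlinarith)
      exact ⟨hp1.trans hqp, 1, one_pos, u,
        fun x hx => (hu x (ne_zero_of_coord_pos hx.1)).contDiffWithinAt,
        fun x hx _ => hpos x hx, fun x hx _ => hsup x hx⟩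
  refine ⟨hS, ?_, ?_⟩
  · rw [hS]
    exact csInf_Ioi
  · rw [hS]
    exact lt_irrefl p
end
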